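/- arXiv:2510.27311 — 2 statements merged into one kernel-verified Lean document; each statement's English description precedes it below -/
import Mathlib

section
/- Let L be a finite geometric lattice with minimum 0̂ and let X ∈ L with X ≠ 0̂. Then the reduced homology of the order complex of the open interval (0̂, X) is free abelian of rank |μ(0̂, X)| concentrated in dimension rk(X) - 2, and vanishes in all other dimensions. -/
noncomputable section

variable {L : Type*} [Lattice L] [OrderBot L]

/-- `k`-simplices of the order complex of the open interval `(⊥, X)`: strictly increasing
`(k+1)`-chains in `(⊥, X)`. -/
def OC (X : L) (k : ℕ) : Type _ :=
  {f : Fin (k + 1) → L // StrictMono f ∧ ∀ i, ⊥ < f i ∧ f i < X}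

/-- Simplicial chains of the order complex of `(⊥, X)`. -/
def Ch (X : L) (k : ℕ) : Type _ := OC X k →₀ ℤ

instance (X : L) (k : ℕ) : AddCommGroup (Ch X k) := Finsupp.instAddCommGroup
instance (X : L) (k : ℕ) : Module ℤ (Ch X k) := Finsupp.module _ _

/-- The `i`-th face of a simplex: delete the `i`-th vertex. -/
def faceOC (X : L) {k : ℕ} (i : Fin (k + 2)) (f : OC X (k + 1)) : OC X k :=
  ⟨f.val ∘ i.succAbove, f.prop.1.comp (Fin.strictMono_succAbove i), fun l => f.prop.2 _⟩

/-- The simplicial boundary map of the order complex. -/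
def bd (X : L) (k : ℕ) : Ch X (k + 1) →ₗ[ℤ] Ch X k :=
  Finsupp.lift (Ch X k) ℤ (OC X (k + 1))
    (fun f => ∑ i : Fin (k + 2), ((-1 : ℤ) ^ (i : ℕ)) • Finsupp.single (faceOC X i f) (1 : ℤ))

/-- The augmentation map. -/
def augOC (X : L) : Ch X 0 →ₗ[ℤ] ℤ :=
  Finsupp.lift ℤ ℤ (OC X 0) (fun _ => (1 : ℤ))

/-- Reduced cycles in degree `k` (using the augmentation in degree `0`). -/
def cyc (X : L) : (k : ℕ) → Submodule ℤ (Ch X k)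
  | 0 => LinearMap.ker (augOC X)
  | (k + 1) => LinearMap.ker (bd X k)

/-- Boundaries in degree `k`. -/
def bdr (X : L) (k : ℕ) : Submodule ℤ (Ch X k) := LinearMap.range (bd X k)

/-- The `k`-th reduced simplicial homology of the order complex of `(⊥, X)`. -/
def Hred (X : L) (k : ℕ) : Type _ :=
  ↥(cyc X k) ⧸ Submodule.comap (cyc X k).subtype (bdr X k ⊓ cyc X k)

instance (X : L) (k : ℕ) : AddCommGroup (Hred X k) := QuotientAddGroup.Quotient.addCommGroup _

/-- Reduced homology in dimension `-1` (the cokernel of the augmentation). -/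
def HredNeg (X : L) : Type _ := ℤ ⧸ (LinearMap.range (augOC X)).toAddSubgroup

instance (X : L) : AddCommGroup (HredNeg X) := QuotientAddGroup.Quotient.addCommGroup _

section ChainComplex

open Finsupp

variable {α : Type*}

/-- The tail of a list whose head is `h`, and `0` for all other lists. -/
def listTailAt (h : α) : List α → (List α →₀ ℤ)
  | [] => 0
  | x :: l =>
    open Classical in if x = h then single l 1 else 0

/-- The linear extension of `listTailAt`. -/
def tailAt (h : α) : (List α →₀ ℤ) →ₗ[ℤ] (List α →₀ ℤ) :=
  Finsupp.lift _ ℤ _ (listTailAt h)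

@[simp] lemma tailAt_single (h : α) (l : List α) :
    tailAt h (single l 1) = listTailAt h l := by
  simp [tailAt]

lemma listTailAt_of_notMem {x : α} {l : List α} (h : x ∉ l) : listTailAt x l = 0 := by
  cases l with
  | nil => rfl
  | cons y l => exact if_neg (by rintro rfl; simp at h)

variable [PartialOrder α]

/-- Prepending `x` to the strictly decreasing lists all of whose entries are below `x`; all other
lists are sent to `0`. -/
def strictCons (x : α) : (List α →₀ ℤ) →ₗ[ℤ] (List α →₀ ℤ) :=
  open Classical in
  Finsupp.lift _ ℤ _ (fun l => if ∀ y ∈ l, y < x then single (x :: l) 1 else 0)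

/-- The alternating sum of the lists obtained by deleting one entry. -/
def listBoundary : List α → (List α →₀ ℤ)
  | [] => 0
  | x :: l => single l 1 - strictCons x (listBoundary l)

/-- The linear extension of `listBoundary`. -/
def boundary : (List α →₀ ℤ) →ₗ[ℤ] (List α →₀ ℤ) :=
  Finsupp.lift _ ℤ _ listBoundary

/-- The map on normalized chains induced by a self-map of the poset, on lists. -/
def listMapChain (f : α → α) : List α → (List α →₀ ℤ)
  | [] => single [] 1
  | x :: l => strictCons (f x) (listMapChain f l)

/-- The map on normalized chains induced by a self-map of the poset. -/
def mapChain (f : α → α) : (List α →₀ ℤ) →ₗ[ℤ] (List α →₀ ℤ) :=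
  Finsupp.lift _ ℤ _ (listMapChain f)

/-- The prism operator between two self-maps of the poset, on lists. -/
def listPrism (f g : α → α) : List α → (List α →₀ ℤ)
  | [] => 0
  | x :: l => strictCons (f x) (strictCons (g x) (listMapChain g l)) -
      strictCons (f x) (listPrism f g l)

/-- The prism operator between two self-maps of the poset. -/
def prism (f g : α → α) : (List α →₀ ℤ) →ₗ[ℤ] (List α →₀ ℤ) :=
  Finsupp.lift _ ℤ _ (listPrism f g)

/-- The combinations of strictly decreasing lists of length `n` with entries in `S`. -/
def chains (S : Set α) (n : ℕ) : Submodule ℤ (List α →₀ ℤ) :=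
  Finsupp.supported ℤ ℤ {l | l.Pairwise (· > ·) ∧ (∀ x ∈ l, x ∈ S) ∧ l.length = n}

lemma strictCons_single {x : α} {l : List α} (h : ∀ y ∈ l, y < x) :
    strictCons x (single l 1) = single (x :: l) 1 := by
  simp only [strictCons, Finsupp.lift_apply]
  rw [Finsupp.sum_single_index (by simp), if_pos h, one_smul]

lemma strictCons_single_of_not {x : α} {l : List α} (h : ¬ ∀ y ∈ l, y < x) :
    strictCons x (single l 1) = 0 := by
  simp only [strictCons, Finsupp.lift_apply]
  rw [Finsupp.sum_single_index (by simp), if_neg h, smul_zero]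

@[simp] lemma boundary_single (l : List α) : boundary (single l 1) = listBoundary l := by
  simp [boundary]

@[simp] lemma mapChain_single (f : α → α) (l : List α) :
    mapChain f (single l 1) = listMapChain f l := by
  simp [mapChain]

@[simp] lemma prism_single (f g : α → α) (l : List α) :
    prism f g (single l 1) = listPrism f g l := by
  simp [prism]

lemma single_mem_chains {S : Set α} {n : ℕ} {l : List α} (h : l.Pairwise (· > ·))
    (hS : ∀ x ∈ l, x ∈ S) (hn : l.length = n) : (single l 1 : List α →₀ ℤ) ∈ chains S n :=
  Finsupp.single_mem_supported _ _ ⟨h, hS, hn⟩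

lemma chains_mono {S T : Set α} (h : S ⊆ T) (n : ℕ) : chains S n ≤ chains T n :=
  Finsupp.supported_mono fun _ hl => ⟨hl.1, fun x hx => h (hl.2.1 x hx), hl.2.2⟩

lemma chains_eq_span (S : Set α) (n : ℕ) :
    chains S n = Submodule.span ℤ ((fun l => single l (1 : ℤ)) ''
      {l : List α | l.Pairwise (· > ·) ∧ (∀ x ∈ l, x ∈ S) ∧ l.length = n}) :=
  Finsupp.supported_eq_span_single _ _

lemma map_mem_of_mem_chains {M : Type*} [AddCommGroup M] {S : Set α} {n : ℕ}
    (f : (List α →₀ ℤ) →ₗ[ℤ] M) (N : Submodule ℤ M)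
    (h : ∀ l : List α, l.Pairwise (· > ·) → (∀ x ∈ l, x ∈ S) → l.length = n → f (single l 1) ∈ N)
    {c : List α →₀ ℤ} (hc : c ∈ chains S n) : f c ∈ N := by
  have : chains S n ≤ N.comap f := by
    rw [chains_eq_span, Submodule.span_le]
    rintro _ ⟨l, hl, rfl⟩
    exact h l hl.1 hl.2.1 hl.2.2
  exact this hc

lemma eq_of_mem_chains {M : Type*} [AddCommGroup M] {S : Set α} {n : ℕ}
    (f g : (List α →₀ ℤ) →ₗ[ℤ] M)
    (h : ∀ l : List α, l.Pairwise (· > ·) → (∀ x ∈ l, x ∈ S) → l.length = n →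
      f (single l 1) = g (single l 1))
    {c : List α →₀ ℤ} (hc : c ∈ chains S n) : f c = g c := by
  have := map_mem_of_mem_chains (f - g) ⊥ (fun l h1 h2 h3 => by simp [h l h1 h2 h3]) hc
  simpa [sub_eq_zero] using this

lemma strictCons_mem_chains {S : Set α} {n : ℕ} {x : α} (hx : x ∈ S) {c : List α →₀ ℤ}
    (hc : c ∈ chains S n) : strictCons x c ∈ chains S (n + 1) := by
  refine map_mem_of_mem_chains _ _ (fun l h1 h2 h3 => ?_) hc
  by_cases h : ∀ y ∈ l, y < x
  · rw [strictCons_single h]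
    exact single_mem_chains (List.pairwise_cons.2 ⟨h, h1⟩) (by simpa [hx] using h2) (by simp [h3])
  · rw [strictCons_single_of_not h]
    exact Submodule.zero_mem _

lemma listBoundary_mem_chains {S : Set α} {l : List α} (h : l.Pairwise (· > ·))
    (hS : ∀ x ∈ l, x ∈ S) : listBoundary l ∈ chains S (l.length - 1) := by
  induction l with
  | nil => exact Submodule.zero_mem _
  | cons x l ih =>
    rw [List.pairwise_cons] at h
    rw [List.forall_mem_cons] at hS
    refine Submodule.sub_mem _ (single_mem_chains h.2 hS.2 rfl) ?_
    cases l with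
    | nil => simp [listBoundary]
    | cons y l => exact strictCons_mem_chains hS.1 (ih h.2 hS.2)

lemma boundary_mem_chains {S : Set α} {n : ℕ} {c : List α →₀ ℤ} (hc : c ∈ chains S n) :
    boundary c ∈ chains S (n - 1) := by
  refine map_mem_of_mem_chains _ _ (fun l h1 h2 h3 => ?_) hc
  rw [boundary_single, ← h3]
  exact listBoundary_mem_chains h1 h2

lemma boundary_eq_zero_of_mem_chains_zero {S : Set α} {c : List α →₀ ℤ} (hc : c ∈ chains S 0) :
    boundary c = 0 := by
  refine eq_of_mem_chains boundary 0 (fun l _ _ h3 => ?_) hc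
  simp [List.length_eq_zero_iff.1 h3, listBoundary]

lemma listMapChain_mem_chains {S T : Set α} {f : α → α} (hf : Set.MapsTo f S T) {l : List α}
    (hS : ∀ x ∈ l, x ∈ S) : listMapChain f l ∈ chains T l.length := by
  induction l with
  | nil => exact single_mem_chains List.Pairwise.nil (by simp) rfl
  | cons x l ih =>
    rw [List.forall_mem_cons] at hS
    exact strictCons_mem_chains (hf hS.1) (ih hS.2)

lemma mapChain_mem_chains {S T : Set α} {f : α → α} (hf : Set.MapsTo f S T) {n : ℕ}
    {c : List α →₀ ℤ} (hc : c ∈ chains S n) : mapChain f c ∈ chains T n := by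
  refine map_mem_of_mem_chains _ _ (fun l _ h2 h3 => ?_) hc
  rw [mapChain_single, ← h3]
  exact listMapChain_mem_chains hf h2

lemma listPrism_mem_chains {S T : Set α} {f g : α → α} (hf : Set.MapsTo f S T)
    (hg : Set.MapsTo g S T) {l : List α}
    (hS : ∀ x ∈ l, x ∈ S) : listPrism f g l ∈ chains T (l.length + 1) := by
  induction l with
  | nil => exact Submodule.zero_mem _
  | cons x l ih =>
    rw [List.forall_mem_cons] at hS
    exact Submodule.sub_mem _
      (strictCons_mem_chains (hf hS.1)
        (strictCons_mem_chains (hg hS.1) (listMapChain_mem_chains hg hS.2)))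
      (strictCons_mem_chains (hf hS.1) (ih hS.2))

lemma prism_mem_chains {S T : Set α} {f g : α → α} (hf : Set.MapsTo f S T)
    (hg : Set.MapsTo g S T) {n : ℕ} {c : List α →₀ ℤ} (hc : c ∈ chains S n) :
    prism f g c ∈ chains T (n + 1) := by
  refine map_mem_of_mem_chains _ _ (fun l _ h2 h3 => ?_) hc
  rw [prism_single, ← h3]
  exact listPrism_mem_chains hf hg h2

lemma strictCons_strictCons_self (x : α) (c : List α →₀ ℤ) :
    strictCons x (strictCons x c) = 0 := by
  suffices h : strictCons x ∘ₗ strictCons x = 0 from LinearMap.congr_fun h c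
  ext1 l
  ext1
  by_cases h : ∀ y ∈ l, y < x
  · simp [strictCons_single h, strictCons_single_of_not]
  · simp [strictCons_single_of_not h]

lemma boundary_strictCons {x : α} {n : ℕ} {c : List α →₀ ℤ} (hc : c ∈ chains (Set.Iic x) n) :
    boundary (strictCons x c) = c - strictCons x (boundary c) := by
  refine eq_of_mem_chains (boundary ∘ₗ strictCons x)
    (LinearMap.id - strictCons x ∘ₗ boundary) (fun l h1 h2 _ => ?_) hc
  simp only [LinearMap.comp_apply, LinearMap.sub_apply, LinearMap.id_apply, boundary_single]
  by_cases h : ∀ y ∈ l, y < x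
  · rw [strictCons_single h, boundary_single, listBoundary]
  · rw [strictCons_single_of_not h, map_zero]
    cases l with
    | nil => simp at h
    | cons y l =>
      rw [List.pairwise_cons] at h1
      rw [List.forall_mem_cons] at h2
      obtain rfl : y = x := by
        refine (eq_of_le_of_not_lt h2.1 fun hlt => h ?_)
        rw [List.forall_mem_cons]
        exact ⟨hlt, fun z hz => (h1.1 z hz).trans hlt⟩
      rw [listBoundary, map_sub, strictCons_single h1.1, strictCons_strictCons_self]
      simp

lemma mapChain_strictCons (f : α → α) {x : α} {n : ℕ} {c : List α →₀ ℤ}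
    (hc : c ∈ chains (Set.Iio x) n) :
    mapChain f (strictCons x c) = strictCons (f x) (mapChain f c) := by
  refine eq_of_mem_chains (mapChain f ∘ₗ strictCons x)
    (strictCons (f x) ∘ₗ mapChain f) (fun l _ h2 _ => ?_) hc
  simp [strictCons_single h2, listMapChain]

lemma prism_strictCons (f g : α → α) {x : α} {n : ℕ} {c : List α →₀ ℤ}
    (hc : c ∈ chains (Set.Iio x) n) :
    prism f g (strictCons x c) =
      strictCons (f x) (strictCons (g x) (mapChain g c)) - strictCons (f x) (prism f g c) := by
  refine eq_of_mem_chains (prism f g ∘ₗ strictCons x)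
    (strictCons (f x) ∘ₗ strictCons (g x) ∘ₗ mapChain g - strictCons (f x) ∘ₗ prism f g)
    (fun l _ h2 _ => ?_) hc
  simp [strictCons_single h2, listPrism]

lemma listMapChain_mem_chains_Iic {f : α → α} (hf : Monotone f) {x : α} {l : List α}
    (h : ∀ y ∈ l, y < x) : listMapChain f l ∈ chains (Set.Iic (f x)) l.length :=
  listMapChain_mem_chains (S := Set.Iio x) (f := f) (T := Set.Iic (f x))
    (fun _ hy => hf (Set.mem_Iio.1 hy).le) h

lemma boundary_listMapChain {f : α → α} (hf : Monotone f) {l : List α}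
    (h : l.Pairwise (· > ·)) : boundary (listMapChain f l) = mapChain f (listBoundary l) := by
  induction l with
  | nil => simp [listMapChain, listBoundary]
  | cons x l ih =>
    rw [List.pairwise_cons] at h
    rw [listMapChain, boundary_strictCons (listMapChain_mem_chains_Iic hf h.1), ih h.2,
      listBoundary, map_sub, mapChain_single,
      mapChain_strictCons f (listBoundary_mem_chains (S := Set.Iio x) h.2 h.1)]

lemma boundary_mapChain {f : α → α} (hf : Monotone f) {S : Set α} {n : ℕ} {c : List α →₀ ℤ}
    (hc : c ∈ chains S n) : boundary (mapChain f c) = mapChain f (boundary c) := by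
  refine eq_of_mem_chains (boundary ∘ₗ mapChain f) (mapChain f ∘ₗ boundary)
    (fun l h1 _ _ => ?_) hc
  simpa using boundary_listMapChain hf h1

lemma boundary_listPrism {f g : α → α} (hf : Monotone f) (hg : Monotone g) (hgf : g ≤ f)
    {l : List α} (h : l.Pairwise (· > ·)) :
    boundary (listPrism f g l) =
      listMapChain g l - listMapChain f l - prism f g (listBoundary l) := by
  induction l with
  | nil => simp [listPrism, listBoundary, listMapChain]
  | cons x l ih =>
    rw [List.pairwise_cons] at h
    have hmg := listMapChain_mem_chains_Iic hg h.1
    have hbd := listBoundary_mem_chains (S := Set.Iio x) h.2 h.1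
    have hle : Set.Iic (g x) ⊆ Set.Iic (f x) := Set.Iic_subset_Iic.2 (hgf x)
    have hpr : listPrism f g l ∈ chains (Set.Iic (f x)) (l.length + 1) :=
      listPrism_mem_chains (S := Set.Iio x) (f := f) (g := g) (T := Set.Iic (f x))
        (fun _ hy => hf (Set.mem_Iio.1 hy).le)
        (fun y hy => (hgf y).trans (hf (Set.mem_Iio.1 hy).le)) h.1
    rw [listPrism, map_sub, boundary_strictCons hpr, ih h.2,
      boundary_strictCons (chains_mono hle _ (strictCons_mem_chains (Set.mem_Iic.2 le_rfl) hmg)),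
      boundary_strictCons hmg, boundary_listMapChain hg h.2, listBoundary, map_sub (prism f g),
      prism_strictCons f g hbd, prism_single, listMapChain, listMapChain]
    simp only [map_sub]
    abel

lemma boundary_prism {f g : α → α} (hf : Monotone f) (hg : Monotone g) (hgf : g ≤ f)
    {S : Set α} {n : ℕ} {c : List α →₀ ℤ} (hc : c ∈ chains S n) :
    boundary (prism f g c) = mapChain g c - mapChain f c - prism f g (boundary c) := by
  refine eq_of_mem_chains (boundary ∘ₗ prism f g)
    (mapChain g - mapChain f - prism f g ∘ₗ boundary) (fun l h1 _ _ => ?_) hc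
  simpa using boundary_listPrism hf hg hgf h1

lemma listMapChain_id {l : List α} (h : l.Pairwise (· > ·)) :
    listMapChain id l = single l 1 := by
  induction l with
  | nil => rfl
  | cons x l ih =>
    rw [List.pairwise_cons] at h
    rw [listMapChain, ih h.2, id, strictCons_single h.1]

lemma mapChain_id {S : Set α} {n : ℕ} {c : List α →₀ ℤ} (hc : c ∈ chains S n) :
    mapChain id c = c := by
  refine eq_of_mem_chains (mapChain id) LinearMap.id (fun l h1 _ _ => ?_) hc
  rw [mapChain_single, LinearMap.id_apply, listMapChain_id h1]

/-- A poset with a closure operator whose image has a least element is acyclic. -/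
lemma exists_boundary_eq {S : Set α} {f : α → α} {a : α} (hf : Monotone f) (hle : ∀ x, x ≤ f x)
    (hfS : Set.MapsTo f S S) (ha : a ∈ S) (haf : ∀ x, a ≤ f x) {n : ℕ} {c : List α →₀ ℤ}
    (hc : c ∈ chains S n) (hcyc : boundary c = 0) : ∃ w ∈ chains S (n + 1), boundary w = c := by
  have hconst : Monotone fun _ : α => a := monotone_const
  have hmem := mapChain_mem_chains (f := fun _ => a) (T := {a}) (fun _ _ => rfl) hc
  refine ⟨prism f id c - prism f (fun _ => a) c + strictCons a (mapChain (fun _ => a) c),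
    Submodule.add_mem _ (Submodule.sub_mem _ (prism_mem_chains hfS (Set.mapsTo_id S) hc)
      (prism_mem_chains hfS (fun _ _ => ha) hc))
      (strictCons_mem_chains ha (mapChain_mem_chains (fun _ _ => ha) hc)), ?_⟩
  rw [map_add, map_sub, boundary_prism hf monotone_id hle hc, boundary_prism hf hconst haf hc,
    boundary_strictCons (chains_mono (by simp) _ hmem), boundary_mapChain hconst hc, hcyc,
    mapChain_id hc]
  simp

lemma tailAt_strictCons_self {x : α} {n : ℕ} {c : List α →₀ ℤ}
    (hc : c ∈ chains (Set.Iio x) n) : tailAt x (strictCons x c) = c := by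
  refine eq_of_mem_chains (tailAt x ∘ₗ strictCons x) LinearMap.id (fun l _ h2 _ => ?_) hc
  simp [strictCons_single h2, listTailAt]

lemma tailAt_strictCons_of_ne {x y : α} (h : y ≠ x) (c : List α →₀ ℤ) :
    tailAt x (strictCons y c) = 0 := by
  suffices h : tailAt x ∘ₗ strictCons y = 0 from LinearMap.congr_fun h c
  ext1 l
  ext1
  by_cases hl : ∀ z ∈ l, z < y
  · simp [strictCons_single hl, listTailAt, h]
  · simp [strictCons_single_of_not hl]

lemma tailAt_of_notMem {S : Set α} {x : α} (h : x ∉ S) {n : ℕ} {c : List α →₀ ℤ}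
    (hc : c ∈ chains S n) : tailAt x c = 0 := by
  refine eq_of_mem_chains (tailAt x) 0 (fun l _ h2 _ => ?_) hc
  rw [tailAt_single, listTailAt_of_notMem fun hx => h (h2 x hx), LinearMap.zero_apply]

lemma tailAt_mem_chains {S : Set α} {x : α} {n : ℕ} {c : List α →₀ ℤ}
    (hc : c ∈ chains S (n + 1)) : tailAt x c ∈ chains (S ∩ Set.Iio x) n := by
  refine map_mem_of_mem_chains _ _ (fun l h1 h2 h3 => ?_) hc
  cases l with
  | nil => simp at h3
  | cons y l =>
    rw [List.pairwise_cons] at h1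
    rw [List.forall_mem_cons] at h2
    by_cases h : y = x
    · subst h
      simpa [listTailAt] using single_mem_chains (S := S ∩ Set.Iio y) h1.2
        (fun z hz => ⟨h2.2 z hz, h1.1 z hz⟩) (by simpa using h3)
    · simp [listTailAt, h]

lemma tailAt_boundary {S : Set α} {x : α} (hmax : ∀ y ∈ S, ¬ x < y) {n : ℕ} {c : List α →₀ ℤ}
    (hc : c ∈ chains S n) : tailAt x (boundary c) = - boundary (tailAt x c) := by
  refine eq_of_mem_chains (tailAt x ∘ₗ boundary) (-(boundary ∘ₗ tailAt x))
    (fun l h1 h2 _ => ?_) hc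
  cases l with
  | nil => simp [listTailAt, listBoundary]
  | cons y l =>
    rw [List.pairwise_cons] at h1
    rw [List.forall_mem_cons] at h2
    have hx : x ∉ l := fun hx => hmax y h2.1 (h1.1 x hx)
    simp only [LinearMap.comp_apply, LinearMap.neg_apply, boundary_single, tailAt_single,
      listBoundary, map_sub, listTailAt_of_notMem hx]
    by_cases h : y = x
    · subst h
      rw [tailAt_strictCons_self (listBoundary_mem_chains (S := Set.Iio y) h1.2 h1.1)]
      simp [listTailAt]
    · simp [tailAt_strictCons_of_ne h, listTailAt, h]

lemma sub_sum_strictCons_tailAt_mem_chains {S : Set α} {A : Finset α}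
    (hmax : ∀ x ∈ A, ∀ y ∈ S, ¬ x < y) {n : ℕ} {c : List α →₀ ℤ} (hc : c ∈ chains S n) :
    c - ∑ x ∈ A, strictCons x (tailAt x c) ∈ chains (S \ A) n := by
  have := map_mem_of_mem_chains (LinearMap.id - ∑ x ∈ A, strictCons x ∘ₗ tailAt x)
    (chains (S \ A) n) (fun l h1 h2 h3 => ?_) hc
  · simpa using this
  simp only [LinearMap.sub_apply, LinearMap.id_apply, LinearMap.sum_apply, LinearMap.comp_apply,
    tailAt_single]
  cases l with
  | nil => simpa [listTailAt] using single_mem_chains List.Pairwise.nil (by simp) h3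
  | cons y l =>
    have h1' := h1
    have h2' := h2
    rw [List.pairwise_cons] at h1
    rw [List.forall_mem_cons] at h2
    by_cases hy : y ∈ A
    · rw [Finset.sum_eq_single_of_mem y hy fun x _ hxy => by simp [listTailAt, hxy.symm]]
      simp [listTailAt, strictCons_single h1.1]
    · rw [Finset.sum_eq_zero fun x hx => by
        rw [listTailAt, if_neg (by rintro rfl; exact hy hx), map_zero], sub_zero]
      refine single_mem_chains h1' (fun x hx => ⟨h2' x hx, fun hxA => ?_⟩) h3
      rcases List.mem_cons.1 hx with rfl | hx
      · exact hy hxA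
      · exact hmax x hxA y h2.1 (h1.1 x hx)

/-- The cycles of length `n` with entries in `S`. -/
def cycles (S : Set α) (n : ℕ) : Submodule ℤ (List α →₀ ℤ) :=
  chains S n ⊓ LinearMap.ker boundary

end ChainComplex

section Semimodular

/-- There is a saturated chain of length `n` from `x` to `y`. -/
def HasSaturatedChain {α : Type*} [Preorder α] : ℕ → α → α → Prop
  | 0, x, y => x = y
  | n + 1, x, y => ∃ z, x ⋖ z ∧ HasSaturatedChain n z y

namespace HasSaturatedChain

lemma le {α : Type*} [Preorder α] {n : ℕ} {x y : α} (h : HasSaturatedChain n x y) : x ≤ y := by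
  induction n generalizing x with
  | zero => exact le_of_eq h
  | succ n ih =>
    obtain ⟨z, hxz, hz⟩ := h
    exact hxz.le.trans (ih hz)

lemma trans {α : Type*} [Preorder α] {m n : ℕ} {x y z : α} (h : HasSaturatedChain m x y)
    (h' : HasSaturatedChain n y z) : HasSaturatedChain (m + n) x z := by
  induction m generalizing x with
  | zero =>
    obtain rfl : x = y := h
    rwa [Nat.zero_add]
  | succ m ih =>
    obtain ⟨w, hxw, hw⟩ := h
    rw [Nat.succ_add]
    exact ⟨w, hxw, ih hw⟩

lemma exists_of_le {α : Type*} [PartialOrder α] [Finite α] {x y : α} (h : x ≤ y) :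
    ∃ n, HasSaturatedChain n x y := by
  induction x using WellFoundedGT.induction with
  | _ x ih =>
    rcases h.eq_or_lt with rfl | h
    · exact ⟨0, rfl⟩
    · obtain ⟨z, hxz, hzy⟩ := exists_covBy_le_of_lt h
      obtain ⟨n, hn⟩ := ih z hxz.lt hzy
      exact ⟨n + 1, z, hxz, hn⟩

/-- The Jordan–Dedekind chain condition. -/
lemma length_unique {α : Type*} [Lattice α] [Finite α]
    (hsemimod : ∀ a b : α, a ⊓ b ⋖ a → b ⋖ a ⊔ b) {m n : ℕ} {x y : α}
    (hm : HasSaturatedChain m x y) (hn : HasSaturatedChain n x y) : m = n := by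
  induction m generalizing x n with
  | zero =>
    obtain rfl : x = y := hm
    cases n with
    | zero => rfl
    | succ n =>
      obtain ⟨z, hxz, hz⟩ := hn
      exact absurd hz.le hxz.lt.not_ge
  | succ m ih =>
    obtain ⟨u, hxu, hu⟩ := hm
    cases n with
    | zero =>
      obtain rfl : x = y := hn
      exact absurd hu.le hxu.lt.not_ge
    | succ n =>
      obtain ⟨v, hxv, hv⟩ := hn
      by_cases huv : u = v
      · subst huv
        rw [ih hu hv]
      · have hinf : u ⊓ v = x := by
          refine (hxu.eq_or_eq (le_inf hxu.le hxv.le) inf_le_left).resolve_right fun h => ?_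
          exact (hxv.eq_or_eq hxu.le (inf_eq_left.1 h)).elim hxu.ne' huv
        have huj : u ⋖ u ⊔ v := by
          rw [sup_comm]
          exact hsemimod v u (by rwa [inf_comm, hinf])
        have hvj : v ⋖ u ⊔ v := hsemimod u v (by rwa [hinf])
        obtain ⟨k, hk⟩ := exists_of_le (sup_le hu.le hv.le)
        have h1 := ih hu (n := k + 1) ⟨_, huj, hk⟩
        have h2 := ih (n := n) (x := v) (by rw [h1]; exact ⟨_, hvj, hk⟩) hv
        rw [h2]

lemma height_eq {α : Type*} [Lattice α] [OrderBot α] [Finite α]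
    (hsemimod : ∀ a b : α, a ⊓ b ⋖ a → b ⋖ a ⊔ b) {n : ℕ} {x : α}
    (h : HasSaturatedChain n ⊥ x) : Order.height x = n := by
  induction x using WellFoundedLT.induction generalizing n with
  | _ x ih =>
    refine le_antisymm (Order.height_le_coe_iff.2 fun y hy => ?_) ?_
    · obtain ⟨m, hm⟩ := exists_of_le (bot_le : ⊥ ≤ y)
      obtain ⟨k, hk⟩ := exists_of_le hy.le
      rw [ih y hy hm, Nat.cast_lt, length_unique hsemimod h (hm.trans hk)]
      refine Nat.lt_add_of_pos_right (Nat.pos_of_ne_zero ?_)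
      rintro rfl
      exact hy.ne hk
    · clear ih
      suffices H : ∀ (n : ℕ) (y : α), HasSaturatedChain n y x →
          Order.height y + n ≤ Order.height x by simpa using H n ⊥ h
      clear h n
      intro n
      induction n with
      | zero => rintro y rfl; simp
      | succ n ihn =>
        rintro y ⟨z, hyz, hz⟩
        refine le_trans ?_ (ihn z hz)
        rw [Nat.cast_add, Nat.cast_one, add_comm (n : ℕ∞), ← add_assoc]
        gcongr
        exact Order.height_add_one_le hyz.lt

end HasSaturatedChain

lemma CovBy.height_eq_add_one {α : Type*} [Lattice α] [OrderBot α] [Finite α]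
    (hsemimod : ∀ a b : α, a ⊓ b ⋖ a → b ⋖ a ⊔ b) {x y : α} (h : x ⋖ y) :
    Order.height y = Order.height x + 1 := by
  obtain ⟨n, hn⟩ := HasSaturatedChain.exists_of_le (bot_le : ⊥ ≤ x)
  rw [hn.height_eq hsemimod, (hn.trans (n := 1) ⟨y, h, rfl⟩).height_eq hsemimod]
  simp

/-- Weisner's theorem. -/
lemma sum_filter_sup_eq_zero {α : Type*} [Lattice α] [OrderBot α] [Fintype α] [DecidableEq α]
    [DecidableRel (· ≤ · : α → α → Prop)] {μ : α → ℤ}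
    (hμ : ∀ y, y ≠ ⊥ → ∑ x with x ≤ y, μ x = 0) {a : α} (ha : a ≠ ⊥) {y : α} (hy : a ≤ y) :
    ∑ x with x ⊔ a = y, μ x = 0 := by
  induction y using WellFoundedLT.induction with
  | _ y ih =>
    have key : ∑ z with a ≤ z ∧ z ≤ y, ∑ x with x ⊔ a = z, μ x = 0 := by
      rw [← hμ y (ne_bot_of_le_ne_bot ha hy),
        ← Finset.sum_fiberwise_of_maps_to (s := {x | x ≤ y}) (t := {z | a ≤ z ∧ z ≤ y})
          (g := fun x => x ⊔ a) (by intro x; simp +contextual [hy])]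
      refine Finset.sum_congr rfl fun z hz => Finset.sum_congr ?_ fun _ _ => rfl
      ext x
      simp only [Finset.mem_filter, Finset.mem_univ, true_and] at hz ⊢
      exact ⟨fun h => ⟨le_sup_left.trans (h.le.trans hz.2), h⟩, fun h => h.2⟩
    rwa [Finset.sum_eq_single_of_mem y (by simp [hy])] at key
    intro z hz hzy
    simp only [Finset.mem_filter, Finset.mem_univ, true_and] at hz
    exact ih z (lt_of_le_of_ne hz.2 hzy) hz.1

lemma length_add_one_le_height {α : Type*} [PartialOrder α] [OrderBot α] {X : α} (hX : X ≠ ⊥)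
    {l : List α} (h : l.Pairwise (· > ·)) (hl : ∀ x ∈ l, x ∈ Set.Ioo ⊥ X) :
    (l.length : ℕ∞) + 1 ≤ Order.height X := by
  induction l generalizing X with
  | nil =>
    simpa [Order.one_le_iff_pos] using Order.height_pos_of_bot_lt (bot_lt_iff_ne_bot.2 hX)
  | cons x l ih =>
    rw [List.pairwise_cons] at h
    rw [List.forall_mem_cons] at hl
    have := ih hl.1.1.ne' h.2 fun y hy => ⟨(hl.2 y hy).1, h.1 y hy⟩
    refine le_trans ?_ (Order.height_add_one_le hl.1.2)
    rw [List.length_cons, Nat.cast_add, Nat.cast_one]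
    gcongr

lemma chains_Ioo_eq_bot {α : Type*} [PartialOrder α] [OrderBot α] {X : α} (hX : X ≠ ⊥) {n : ℕ}
    (hn : Order.height X < n + 1) : chains (Set.Ioo ⊥ X) n = ⊥ := by
  rw [chains_eq_span, Submodule.span_eq_bot]
  rintro _ ⟨l, ⟨h1, h2, rfl⟩, rfl⟩
  exact absurd hn (length_add_one_le_height hX h1 h2).not_gt

end Semimodular

section Cycles

open Finsupp

variable {α : Type*}

lemma mem_cycles [PartialOrder α] {S : Set α} {n : ℕ} {c : List α →₀ ℤ} :
    c ∈ cycles S n ↔ c ∈ chains S n ∧ boundary c = 0 :=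
  Iff.rfl

instance finite_chains [PartialOrder α] [Finite α] (S : Set α) (n : ℕ) :
    Module.Finite ℤ (chains S n) := by
  have hfin : {l : List α | l.Pairwise (· > ·) ∧ (∀ x ∈ l, x ∈ S) ∧ l.length = n}.Finite :=
    (List.finite_length_eq α n).subset fun l hl => hl.2.2
  have := hfin.to_subtype
  exact Module.Finite.equiv (Finsupp.supportedEquivFinsupp _).symm

instance finite_cycles [PartialOrder α] [Finite α] (S : Set α) (n : ℕ) :
    Module.Finite ℤ (cycles S n) := by
  have : IsNoetherian ℤ (cycles S n) :=
    isNoetherian_of_le (inf_le_left : cycles S n ≤ chains S n)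
  infer_instance

lemma finrank_cycles_zero [PartialOrder α] (S : Set α) : Module.finrank ℤ (cycles S 0) = 1 := by
  have h : cycles S 0 = Submodule.span ℤ {single [] 1} := by
    have h0 : cycles S 0 = chains S 0 :=
      inf_eq_left.2 fun c hc => boundary_eq_zero_of_mem_chains_zero hc
    rw [h0, chains_eq_span]
    congr 1
    ext c
    simp only [Set.mem_image, Set.mem_ofPred_eq, Set.mem_singleton_iff]
    constructor
    · rintro ⟨l, ⟨-, -, h⟩, rfl⟩
      rw [List.length_eq_zero_iff.1 h]
    · rintro rfl
      exact ⟨[], by simp, rfl⟩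
  rw [h, ← (LinearEquiv.toSpanNonzeroSingleton ℤ _ (single ([] : List α) (1 : ℤ))
    (by simp)).finrank_eq, Module.finrank_self]

variable [Lattice α]

/-- The elements covered by `X` that do not lie above `a`. -/
def coatomsAvoiding [Fintype α] (a X : α) : Finset α :=
  open Classical in {H | H ⋖ X ∧ ¬ a ≤ H}

lemma mem_coatomsAvoiding [Fintype α] {a X H : α} :
    H ∈ coatomsAvoiding a X ↔ H ⋖ X ∧ ¬ a ≤ H := by
  simp [coatomsAvoiding]

variable [OrderBot α]

lemma covBy_sup_of_isAtom (hsemimod : ∀ a b : α, a ⊓ b ⋖ a → b ⋖ a ⊔ b) {a x : α}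
    (ha : IsAtom a) (hx : ¬ a ≤ x) : x ⋖ x ⊔ a := by
  rw [sup_comm]
  refine hsemimod a x ?_
  rw [(ha.le_iff.1 inf_le_left).resolve_right fun h => hx (inf_eq_left.1 h)]
  exact ha.bot_covBy

lemma exists_boundary_eq_of_avoiding [Fintype α]
    (hsemimod : ∀ a b : α, a ⊓ b ⋖ a → b ⋖ a ⊔ b) {a X : α} (ha : IsAtom a) (haX : a < X) {n : ℕ}
    {c : List α →₀ ℤ} (hc : c ∈ cycles (Set.Ioo ⊥ X \ coatomsAvoiding a X) n) :
    ∃ w ∈ chains (Set.Ioo ⊥ X \ coatomsAvoiding a X) (n + 1), boundary w = c := by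
  refine exists_boundary_eq (f := fun x => x ⊔ a) (a := a) (fun x y h => sup_le_sup_right h a)
    (fun x => le_sup_left) ?_ ?_ (fun x => le_sup_right) hc.1 hc.2
  · rintro x ⟨⟨h0, hX⟩, hx⟩
    refine ⟨⟨h0.trans_le le_sup_left, lt_of_le_of_ne (sup_le hX.le haX.le) fun h => hx ?_⟩, ?_⟩
    · rw [Finset.mem_coe, mem_coatomsAvoiding]
      have hax : ¬ a ≤ x := fun hax => hX.ne ((sup_eq_left.2 hax).symm.trans h)
      exact ⟨h ▸ covBy_sup_of_isAtom hsemimod ha hax, hax⟩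
    · simp [mem_coatomsAvoiding]
  · exact ⟨⟨ha.bot_lt, haX⟩, by simp [mem_coatomsAvoiding]⟩

lemma tailAt_mem_cycles {X H : α} (hH : H ⋖ X) {n : ℕ} {c : List α →₀ ℤ}
    (hc : c ∈ cycles (Set.Ioo ⊥ X) (n + 1)) : tailAt H c ∈ cycles (Set.Ioo ⊥ H) n := by
  have hsub : Set.Ioo ⊥ X ∩ Set.Iio H ⊆ Set.Ioo ⊥ H := fun x hx => ⟨hx.1.1, hx.2⟩
  refine mem_cycles.2 ⟨chains_mono hsub _ (tailAt_mem_chains hc.1), ?_⟩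
  rw [← neg_eq_zero, ← tailAt_boundary (fun y hy h => hH.2 h hy.2) hc.1,
    LinearMap.mem_ker.1 hc.2, map_zero]

lemma Ioo_subset_avoiding [Fintype α] {a X H : α} (hH : H ∈ coatomsAvoiding a X) :
    Set.Ioo ⊥ H ⊆ Set.Ioo ⊥ X \ coatomsAvoiding a X := by
  rw [mem_coatomsAvoiding] at hH
  refine fun x hx => ⟨⟨hx.1, hx.2.trans hH.1.lt⟩, fun h => ?_⟩
  rw [Finset.mem_coe, mem_coatomsAvoiding] at h
  exact h.1.2 hx.2 hH.1.lt

lemma chains_Iio_of_Ioo {H : α} {n : ℕ} {c : List α →₀ ℤ} (hc : c ∈ chains (Set.Ioo ⊥ H) n) :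
    c ∈ chains (Set.Iio H) n :=
  chains_mono Set.Ioo_subset_Iio_self n hc

lemma boundary_strictCons_of_Ioo {H : α} {n : ℕ} {c : List α →₀ ℤ}
    (hc : c ∈ chains (Set.Ioo ⊥ H) n) :
    boundary (strictCons H c) = c - strictCons H (boundary c) :=
  boundary_strictCons (chains_mono (fun _ hx => (Set.mem_Ioo.1 hx).2.le) n hc)

lemma sub_sum_mem_chains_avoiding [Fintype α] {a X : α} {n : ℕ} {c : List α →₀ ℤ}
    (hc : c ∈ chains (Set.Ioo ⊥ X) n) :
    c - ∑ H ∈ coatomsAvoiding a X, strictCons H (tailAt H c) ∈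
      chains (Set.Ioo ⊥ X \ coatomsAvoiding a X) n :=
  sub_sum_strictCons_tailAt_mem_chains
    (fun _ hx _ hy h => (mem_coatomsAvoiding.1 hx).1.2 h hy.2) hc

lemma mem_Ioo_of_mem_coatomsAvoiding [Fintype α] {a X H : α} (ha : IsAtom a) (haX : a < X)
    (hH : H ∈ coatomsAvoiding a X) : H ∈ Set.Ioo ⊥ X := by
  rw [mem_coatomsAvoiding] at hH
  refine ⟨bot_lt_iff_ne_bot.2 ?_, hH.1.lt⟩
  rintro rfl
  exact hH.1.2 ha.bot_lt haX

/-- The open intervals below an element are acyclic below the top degree. -/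
lemma exists_boundary_eq_of_lt_height [Fintype α]
    (hsemimod : ∀ a b : α, a ⊓ b ⋖ a → b ⋖ a ⊔ b) {X : α} {n : ℕ}
    (hn : (n : ℕ∞) + 1 < Order.height X) {c : List α →₀ ℤ} (hc : c ∈ cycles (Set.Ioo ⊥ X) n) :
    ∃ w ∈ chains (Set.Ioo ⊥ X) (n + 1), boundary w = c := by
  induction X using WellFoundedLT.induction generalizing n c with
  | _ X ih =>
    have hX : X ≠ ⊥ := by rintro rfl; simp at hn
    obtain ⟨a, ha, haX⟩ := (eq_bot_or_exists_atom_le X).resolve_left hX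
    have haX : a < X := by
      refine lt_of_le_of_ne haX ?_
      rintro rfl
      simp [ha.bot_covBy.height_eq_add_one hsemimod] at hn
    set A := coatomsAvoiding a X with hA
    have hsub : Set.Ioo ⊥ X \ A ⊆ Set.Ioo ⊥ X := Set.sdiff_subset
    cases n with
    | zero =>
      have hc' : c ∈ chains (Set.Ioo ⊥ X \ A) 0 := by
        refine map_mem_of_mem_chains LinearMap.id _ (fun l _ _ h => ?_) hc.1
        rw [List.length_eq_zero_iff.1 h]
        exact single_mem_chains List.Pairwise.nil (by simp) rfl
      obtain ⟨w, hw, h⟩ := exists_boundary_eq_of_avoiding hsemimod ha haX ⟨hc', hc.2⟩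
      exact ⟨w, chains_mono hsub _ hw, h⟩
    | succ n =>
      have hex : ∀ H : A, ∃ w ∈ chains (Set.Ioo ⊥ (H : α)) (n + 1), boundary w = tailAt H.1 c := by
        rintro ⟨H, hH⟩
        have hHX := (mem_coatomsAvoiding.1 hH).1
        refine ih H hHX.lt ?_ (tailAt_mem_cycles hHX hc)
        rw [hHX.height_eq_add_one hsemimod, Nat.cast_add, Nat.cast_one] at hn
        exact lt_of_add_lt_add_right hn
      choose e he hde using hex
      have hd : boundary (∑ H : A, strictCons H.1 (e H)) =
          ∑ H : A, e H - ∑ H ∈ A, strictCons H (tailAt H c) := by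
        rw [map_sum, ← Finset.sum_coe_sort A, ← Finset.sum_sub_distrib]
        exact Finset.sum_congr rfl fun H _ => by
          rw [boundary_strictCons_of_Ioo (he H), hde]
      have hmem : c + boundary (∑ H : A, strictCons H.1 (e H)) ∈ chains (Set.Ioo ⊥ X \ A) (n + 1) := by
        rw [hd, add_sub_left_comm]
        exact Submodule.add_mem _
          (Submodule.sum_mem _ fun H _ => chains_mono (Ioo_subset_avoiding H.2) _ (he H))
          (sub_sum_mem_chains_avoiding hc.1)
      have hcyc : boundary (c + boundary (∑ H : A, strictCons H.1 (e H))) = 0 := by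
        rw [map_add, (mem_cycles.1 hc).2, zero_add, map_sum, map_sum]
        refine Finset.sum_eq_zero fun H _ => ?_
        have hcH := mem_cycles.1 (tailAt_mem_cycles (mem_coatomsAvoiding.1 H.2).1 hc)
        rw [boundary_strictCons_of_Ioo (he H), map_sub, hde, boundary_strictCons_of_Ioo hcH.1,
          hcH.2, map_zero, sub_zero, sub_self]
      obtain ⟨w, hw, h⟩ := exists_boundary_eq_of_avoiding hsemimod ha haX ⟨hmem, hcyc⟩
      refine ⟨w - ∑ H : A, strictCons H.1 (e H), Submodule.sub_mem _ (chains_mono hsub _ hw)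
        (Submodule.sum_mem _ fun H _ => ?_), by rw [map_sub, h, add_sub_cancel_right]⟩
      have hHX := mem_Ioo_of_mem_coatomsAvoiding ha haX H.2
      exact strictCons_mem_chains hHX
        (chains_mono (Set.Ioo_subset_Ioo_right hHX.2.le) _ (he H))

/-- Top-dimensional cycles decompose according to the largest entries of chains. -/
lemma finrank_cycles_eq_sum [Fintype α]
    (hsemimod : ∀ a b : α, a ⊓ b ⋖ a → b ⋖ a ⊔ b) {a X : α} (ha : IsAtom a) (haX : a < X) {n : ℕ}
    (hn : (n : ℕ∞) + 2 = Order.height X) :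
    Module.finrank ℤ (cycles (Set.Ioo ⊥ X) (n + 1)) =
      ∑ H ∈ coatomsAvoiding a X, Module.finrank ℤ (cycles (Set.Ioo ⊥ H) n) := by
  set A := coatomsAvoiding a X with hA
  have hsub : Set.Ioo ⊥ X \ A ⊆ Set.Ioo ⊥ X := Set.sdiff_subset
  let F : cycles (Set.Ioo ⊥ X) (n + 1) →ₗ[ℤ] ((H : A) → cycles (Set.Ioo ⊥ (H : α)) n) :=
    LinearMap.pi fun H => (tailAt H.1).restrict fun _ hc =>
      tailAt_mem_cycles (mem_coatomsAvoiding.1 H.2).1 hc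
  have hF : ∀ c (H : A), (F c H : List α →₀ ℤ) = tailAt H.1 c := fun _ _ => rfl
  have hinj : Function.Injective F := by
    rw [injective_iff_map_eq_zero]
    intro c hc0
    have hc0' : ∀ H : A, tailAt H.1 (c : List α →₀ ℤ) = 0 := fun H => by
      rw [← hF, hc0]; rfl
    have hmem := sub_sum_mem_chains_avoiding (a := a) c.2.1
    rw [← hA, ← Finset.sum_coe_sort A] at hmem
    simp only [hc0', map_zero, Finset.sum_const_zero, sub_zero] at hmem
    obtain ⟨w, hw, h⟩ := exists_boundary_eq_of_avoiding hsemimod ha haX ⟨hmem, c.2.2⟩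
    have hw' := chains_mono hsub _ hw
    rw [chains_Ioo_eq_bot (ha.bot_lt.trans haX).ne' (by
      rw [← hn]
      norm_cast
      omega), Submodule.mem_bot] at hw'
    rw [hw', map_zero] at h
    exact Subtype.ext h.symm
  have hsurj : Function.Surjective F := by
    intro e
    have hmem : ∑ H : A, (e H : List α →₀ ℤ) ∈ cycles (Set.Ioo ⊥ X \ A) n :=
      Submodule.sum_mem _ fun H _ => ⟨chains_mono (Ioo_subset_avoiding H.2) _ (e H).2.1, (e H).2.2⟩
    obtain ⟨w, hw, h⟩ := exists_boundary_eq_of_avoiding hsemimod ha haX hmem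
    have hz : ∑ H : A, strictCons H.1 (e H : List α →₀ ℤ) - w ∈ cycles (Set.Ioo ⊥ X) (n + 1) := by
      refine mem_cycles.2 ⟨Submodule.sub_mem _ (Submodule.sum_mem _ fun H _ => ?_) (chains_mono hsub _ hw), ?_⟩
      · have hHX := mem_Ioo_of_mem_coatomsAvoiding ha haX H.2
        exact strictCons_mem_chains hHX
          (chains_mono (Set.Ioo_subset_Ioo_right hHX.2.le) _ (e H).2.1)
      · rw [map_sub, h, map_sum, sub_eq_zero]
        refine Finset.sum_congr rfl fun H _ => ?_
        rw [boundary_strictCons_of_Ioo (e H).2.1, LinearMap.mem_ker.1 (e H).2.2, map_zero, sub_zero]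
    refine ⟨⟨_, hz⟩, ?_⟩
    funext H
    refine Subtype.ext ?_
    rw [hF, map_sub, map_sum, tailAt_of_notMem (fun hH => hH.2 H.2) hw, sub_zero,
      Finset.sum_eq_single_of_mem H (Finset.mem_univ H) fun H' _ hne =>
        tailAt_strictCons_of_ne (fun h => hne (Subtype.ext h)) _,
      tailAt_strictCons_self (chains_Iio_of_Ioo (e H).2.1)]
  rw [(LinearEquiv.ofBijective F ⟨hinj, hsurj⟩).finrank_eq, Module.finrank_pi_fintype,
    Finset.sum_coe_sort A fun H => Module.finrank ℤ (cycles (Set.Ioo ⊥ H) n)]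

/-- The rank of the module of top-dimensional cycles is the Möbius number, up to sign. -/
lemma neg_one_pow_mul_finrank_cycles [Fintype α] [DecidableEq α]
    [DecidableRel (· ≤ · : α → α → Prop)]
    (hsemimod : ∀ a b : α, a ⊓ b ⋖ a → b ⋖ a ⊔ b) {μ : α → ℤ} (hμ0 : μ ⊥ = 1)
    (hμ : ∀ y, y ≠ ⊥ → ∑ x with x ≤ y, μ x = 0) {X : α} {n : ℕ}
    (hn : (n : ℕ∞) + 1 = Order.height X) :
    μ X = (-1) ^ (n + 1) * Module.finrank ℤ (cycles (Set.Ioo ⊥ X) n) := by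
  induction n generalizing X with
  | zero =>
    have hX : X ≠ ⊥ := by rintro rfl; simp at hn
    obtain ⟨a, ha, haX⟩ := (eq_bot_or_exists_atom_le X).resolve_left hX
    have hXat : a = X := by
      refine haX.eq_or_lt.resolve_right fun hlt => ?_
      have := Order.height_add_one_le hlt
      rw [← hn, ha.bot_covBy.height_eq_add_one hsemimod] at this
      norm_num at this
    subst hXat
    have := hμ a hX
    rw [show ({x | x ≤ a} : Finset α) = {⊥, a} by ext x; simp [ha.le_iff],
      Finset.sum_pair hX.symm, hμ0] at this
    rw [finrank_cycles_zero]
    simp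
    linarith
  | succ n ih =>
    have hX : X ≠ ⊥ := by rintro rfl; simp at hn
    obtain ⟨a, ha, haX⟩ := (eq_bot_or_exists_atom_le X).resolve_left hX
    have haX : a < X := by
      refine lt_of_le_of_ne haX ?_
      rintro rfl
      simp [ha.bot_covBy.height_eq_add_one hsemimod] at hn
    have hset : ({x | x ⊔ a = X} : Finset α) = insert X (coatomsAvoiding a X) := by
      ext x
      simp only [Finset.mem_filter, Finset.mem_univ, true_and, Finset.mem_insert,
        mem_coatomsAvoiding]
      constructor
      · intro h
        by_cases hax : a ≤ x
        · exact Or.inl ((sup_eq_left.2 hax).symm.trans h)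
        · exact Or.inr ⟨h ▸ covBy_sup_of_isAtom hsemimod ha hax, hax⟩
      · rintro (rfl | ⟨hxX, hax⟩)
        · exact sup_eq_left.2 haX.le
        · exact (hxX.eq_or_eq le_sup_left (sup_le hxX.le haX.le)).resolve_left
            fun h => hax (sup_eq_left.1 h)
    have hW := sum_filter_sup_eq_zero hμ ha.1 haX.le
    rw [hset, Finset.sum_insert (by simp [mem_coatomsAvoiding])] at hW
    rw [finrank_cycles_eq_sum hsemimod ha haX (by rw [← hn]; norm_cast), Nat.cast_sum, Finset.mul_sum,
      eq_neg_of_add_eq_zero_left hW, ← Finset.sum_neg_distrib]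
    refine Finset.sum_congr rfl fun H hH => ?_
    rw [ih, pow_succ]
    · ring
    · rw [(mem_coatomsAvoiding.1 hH).1.height_eq_add_one hsemimod] at hn
      rw [Nat.cast_add, Nat.cast_one] at hn
      exact ENat.add_left_injective_of_ne_top ENat.one_ne_top hn

end Cycles

section OrderComplex

open Finsupp

lemma listBoundary_ofFn {α : Type*} [PartialOrder α] {n : ℕ} {g : Fin (n + 1) → α}
    (hg : StrictAnti g) :
    listBoundary (List.ofFn g) =
      ∑ i : Fin (n + 1), (-1 : ℤ) ^ (i : ℕ) • single (List.ofFn (g ∘ i.succAbove)) 1 := by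
  induction n with
  | zero => simp [List.ofFn_succ, listBoundary]
  | succ n ih =>
    rw [List.ofFn_succ, listBoundary, Fin.sum_univ_succ, sub_eq_add_neg]
    congr 1
    · simp [Function.comp_def]
    · have h := ih (g := g ∘ Fin.succ) (hg.comp_strictMono (Fin.strictMono_succ))
      rw [show (fun i => g (Fin.succ i)) = g ∘ Fin.succ from rfl, h, map_sum,
        ← Finset.sum_neg_distrib]
      refine Finset.sum_congr rfl fun i _ => ?_
      rw [map_smul, strictCons_single, Fin.val_succ, pow_succ, mul_neg_one, neg_smul]
      · congr 3
        rw [List.ofFn_succ]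
        simp [Function.comp_def]
      · rw [List.forall_mem_ofFn_iff]
        exact fun j => hg (Fin.succ_pos _)

variable {L : Type*} [Lattice L] [OrderBot L] {X : L} {k : ℕ}

/-- The vertices of a simplex, in decreasing order. -/
def vertexList (f : OC X k) : List L := List.ofFn (f.val ∘ Fin.rev)

lemma vertexList_injective : Function.Injective (vertexList : OC X k → List L) := by
  intro f g h
  have h := List.ofFn_injective h
  exact Subtype.ext (funext fun i => by simpa using congrFun h i.rev)

lemma strictAnti_comp_rev (f : OC X k) : StrictAnti (f.val ∘ Fin.rev) :=
  f.prop.1.comp_strictAnti Fin.rev_strictAnti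

lemma single_vertexList_mem_chains (f : OC X k) :
    (single (vertexList f) 1 : List L →₀ ℤ) ∈ chains (Set.Ioo ⊥ X) (k + 1) := by
  refine single_mem_chains ?_ ?_ (List.length_ofFn)
  · rw [vertexList, List.pairwise_ofFn]
    exact fun i j h => strictAnti_comp_rev f h
  · rw [vertexList, List.forall_mem_ofFn_iff]
    exact fun i => f.prop.2 _

lemma exists_vertexList_eq {l : List L} (h : l.Pairwise (· > ·)) (hl : ∀ x ∈ l, x ∈ Set.Ioo ⊥ X)
    (hk : l.length = k + 1) : ∃ f : OC X k, vertexList f = l := by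
  obtain ⟨g, rfl⟩ : ∃ g : Fin (k + 1) → L, List.ofFn g = l := by
    exact ⟨fun i => l.get (i.cast hk.symm), by
      rw [List.ofFn_congr hk.symm]; simp⟩
  rw [List.pairwise_ofFn] at h
  rw [List.forall_mem_ofFn_iff] at hl
  exact ⟨⟨g ∘ Fin.rev, fun i j hij => h (Fin.rev_lt_rev.2 hij), fun i => hl _⟩,
    by simp [vertexList, Function.comp_def]⟩

/-- Simplicial chains of the order complex as combinations of decreasing lists. -/
def toLists (X : L) (k : ℕ) : Ch X k →ₗ[ℤ] (List L →₀ ℤ) :=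
  Finsupp.lmapDomain ℤ ℤ (vertexList : OC X k → List L)

/-- A simplex as a chain. -/
def simplex (f : OC X k) : Ch X k := (single f 1 : OC X k →₀ ℤ)

lemma toLists_simplex (f : OC X k) :
    toLists X k (simplex f) = single (vertexList f) 1 :=
  Finsupp.mapDomain_single

lemma toLists_injective : Function.Injective (toLists X k) :=
  Finsupp.mapDomain_injective vertexList_injective

lemma Ch.hom_ext {M : Type*} [AddCommGroup M] {φ ψ : Ch X k →ₗ[ℤ] M}
    (h : ∀ f : OC X k, φ (simplex f) = ψ (simplex f)) : φ = ψ :=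
  Finsupp.lhom_ext' fun f => LinearMap.ext_ring (h f)

lemma range_toLists : LinearMap.range (toLists X k) = chains (Set.Ioo ⊥ X) (k + 1) := by
  apply le_antisymm
  · rintro _ ⟨c, rfl⟩
    have h : (chains (Set.Ioo ⊥ X) (k + 1)).mkQ ∘ₗ toLists X k = 0 := by
      refine Ch.hom_ext fun f => ?_
      rw [LinearMap.comp_apply, toLists_simplex, LinearMap.zero_apply,
        Submodule.mkQ_apply, Submodule.Quotient.mk_eq_zero]
      exact single_vertexList_mem_chains f
    exact (Submodule.Quotient.mk_eq_zero _).1 (LinearMap.congr_fun h c)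
  · rw [chains_eq_span, Submodule.span_le]
    rintro _ ⟨l, ⟨h1, h2, h3⟩, rfl⟩
    obtain ⟨f, rfl⟩ := exists_vertexList_eq h1 h2 h3
    exact ⟨_, toLists_simplex f⟩

lemma bd_simplex (f : OC X (k + 1)) :
    bd X k (simplex f) =
      ∑ i : Fin (k + 2), (-1 : ℤ) ^ (i : ℕ) • simplex (faceOC X i f) := by
  refine (Finsupp.sum_single_index ?_).trans (one_smul _ _)
  exact zero_smul _ _

lemma boundary_toLists (c : Ch X (k + 1)) :
    boundary (toLists X (k + 1) c) = (-1 : ℤ) ^ (k + 1) • toLists X k (bd X k c) := by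
  suffices h : boundary ∘ₗ toLists X (k + 1) = (-1 : ℤ) ^ (k + 1) • (toLists X k ∘ₗ bd X k) from
    LinearMap.congr_fun h c
  refine Ch.hom_ext fun f => ?_
  rw [LinearMap.comp_apply, toLists_simplex, boundary_single, vertexList,
    listBoundary_ofFn (strictAnti_comp_rev f), LinearMap.smul_apply, LinearMap.comp_apply,
    bd_simplex, map_sum, Finset.smul_sum, ← Equiv.sum_comp Fin.revPerm]
  refine Finset.sum_congr rfl fun i _ => ?_
  rw [map_smul, toLists_simplex, smul_smul]
  congr 1
  · rw [Fin.revPerm_apply, Fin.val_rev, ← pow_add]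
    have hi := i.is_lt
    obtain ⟨j, hj⟩ : ∃ j, k + 1 = i + j := Nat.exists_eq_add_of_le (by omega)
    rw [show k + 2 - (i + 1) = j by omega, show k + 1 + (i : ℕ) = 2 * i + j by omega, pow_add,
      pow_mul]
    simp
  · congr 1
    rw [vertexList]
    congr 1
    funext j
    simp [faceOC, Fin.rev_succAbove]

lemma augOC_simplex (f : OC X 0) : augOC X (simplex f) = 1 := by
  refine (Finsupp.sum_single_index ?_).trans (one_smul _ _)
  exact zero_smul _ _

lemma boundary_toLists_zero (c : Ch X 0) :
    boundary (toLists X 0 c) = single [] (augOC X c) := by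
  suffices h : boundary ∘ₗ toLists X 0 = Finsupp.lsingle [] ∘ₗ augOC X from
    LinearMap.congr_fun h c
  refine Ch.hom_ext fun f => ?_
  rw [LinearMap.comp_apply, toLists_simplex, boundary_single, LinearMap.comp_apply, augOC_simplex,
    vertexList,     listBoundary_ofFn (strictAnti_comp_rev f)]
  simp

lemma toLists_mem_cycles {c : Ch X k} :
    toLists X k c ∈ cycles (Set.Ioo ⊥ X) (k + 1) ↔ c ∈ cyc X k := by
  rw [mem_cycles, ← range_toLists, and_iff_right (LinearMap.mem_range_self _ _)]
  cases k with
  | zero =>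
    rw [boundary_toLists_zero, Finsupp.single_eq_zero]
    rfl
  | succ k =>
    rw [boundary_toLists, smul_eq_zero_iff_right (by simp),
      map_eq_zero_iff _ toLists_injective]
    rfl

lemma mem_bdr_iff {c : Ch X k} :
    c ∈ bdr X k ↔ ∃ w ∈ chains (Set.Ioo ⊥ X) (k + 2), boundary w = toLists X k c := by
  have hsq : ∀ n, (-1 : ℤ) ^ n * (-1) ^ n = 1 := fun n => by rw [← mul_pow]; simp
  constructor
  · rintro ⟨w, rfl⟩
    refine ⟨(-1 : ℤ) ^ (k + 1) • toLists X (k + 1) w, Submodule.smul_mem _ _ ?_, ?_⟩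
    · exact range_toLists.le (LinearMap.mem_range_self _ _)
    · rw [map_smul, boundary_toLists, smul_smul, hsq, one_smul]
  · rintro ⟨w, hw, h⟩
    rw [← range_toLists (k := k + 1)] at hw
    obtain ⟨w, rfl⟩ := hw
    refine ⟨(-1 : ℤ) ^ (k + 1) • w, toLists_injective ?_⟩
    rw [← h, boundary_toLists, map_smul, map_smul]

/-- Reduced cycles of the order complex as cycles of decreasing lists. -/
def cycEquiv (X : L) (k : ℕ) : cyc X k ≃ₗ[ℤ] cycles (Set.Ioo ⊥ X) (k + 1) :=
  LinearEquiv.ofBijective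
    ((toLists X k).restrict fun _ hc => toLists_mem_cycles.2 hc) <| by
    refine ⟨fun c c' h => Subtype.ext (toLists_injective (congrArg Subtype.val h)), ?_⟩
    rintro ⟨z, hz⟩
    obtain ⟨c, rfl⟩ := range_toLists.ge (mem_cycles.1 hz).1
    exact ⟨⟨c, toLists_mem_cycles.1 hz⟩, rfl⟩

lemma subsingleton_Hred (h : cyc X k ≤ bdr X k) : Subsingleton (Hred X k) := by
  refine Submodule.Quotient.subsingleton_iff.2 ?_
  rw [inf_eq_right.2 h, Submodule.comap_subtype_self]

/-- In the top degree there are no boundaries. -/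
def HredEquivCyc (h : bdr X k = ⊥) : Hred X k ≃+ cyc X k :=
  (Submodule.quotEquivOfEqBot _ (by rw [h, bot_inf_eq, Submodule.comap_bot,
    Submodule.ker_subtype])).toAddEquiv

end OrderComplex

/-- let `L` be a finite geometric lattice (atomistic and upper semimodular) and
`X ∈ L`, `X ≠ ⊥`.  The reduced homology of the order complex of the open interval `(⊥, X)` is
free abelian of rank `|μ(⊥,X)|` concentrated in dimension `rk(X) - 2` (interpreted in dimension
`-1` when `X` is an atom), and vanishes in all other dimensions.  Here `μ` is any function
satisfying the defining recursion of the Möbius function of `L`, and `rk = Order.height`. -/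
theorem stmt4 (L : Type*) [Lattice L] [OrderBot L] [Fintype L] [DecidableEq L]
    [DecidableRel (· ≤ · : L → L → Prop)]
    (hatomistic : ∀ a : L, ∃ s : Finset L, (∀ x ∈ s, IsAtom x) ∧ a = s.sup id)
    (hsemimod : ∀ a b : L, a ⊓ b ⋖ a → b ⋖ a ⊔ b)
    (X : L) (hX : X ≠ ⊥)
    (μ : L → L → ℤ) (hμrefl : ∀ a, μ a a = 1)
    (hμrec : ∀ a b : L, a < b → ∑ c : L, (if a ≤ c ∧ c ≤ b then μ a c else 0) = 0) :
    (∀ k : ℕ,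
      (((k : ℕ∞) + 2 ≠ Order.height X) → Subsingleton (Hred X k)) ∧
      (((k : ℕ∞) + 2 = Order.height X) →
        Nonempty ((Hred X k) ≃ₗ[ℤ] (Fin (μ ⊥ X).natAbs → ℤ)))) ∧
    (Order.height X = 1 → Nonempty ((HredNeg X) ≃+ (Fin (μ ⊥ X).natAbs → ℤ))) ∧
    (Order.height X ≠ 1 → Subsingleton (HredNeg X)) := by
  have hμ0 : μ ⊥ ⊥ = 1 := hμrefl ⊥
  have hμ : ∀ y, y ≠ ⊥ → ∑ x with x ≤ y, μ ⊥ x = 0 := fun y hy => by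
    simpa [Finset.sum_filter] using hμrec ⊥ y (bot_lt_iff_ne_bot.2 hy)
  refine ⟨fun k => ⟨fun hk => subsingleton_Hred fun c hc => ?_, fun hk => ?_⟩, fun h1 => ?_,
    fun h1 => ?_⟩
  · rw [mem_bdr_iff]
    rcases lt_or_gt_of_ne hk with hlt | hgt
    · refine exists_boundary_eq_of_lt_height hsemimod ?_ (toLists_mem_cycles.2 hc)
      refine lt_of_eq_of_lt ?_ hlt
      norm_cast
    · have hz := (mem_cycles.1 (toLists_mem_cycles.2 hc)).1
      rw [chains_Ioo_eq_bot hX (lt_of_lt_of_eq hgt (by norm_cast)), Submodule.mem_bot] at hz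
      exact ⟨0, Submodule.zero_mem _, by rw [hz, map_zero]⟩
  · have hbdr : bdr X k = ⊥ := by
      rw [eq_bot_iff]
      intro c hc
      obtain ⟨w, hw, h⟩ := mem_bdr_iff.1 hc
      rw [chains_Ioo_eq_bot hX (by rw [← hk]; norm_cast; omega), Submodule.mem_bot] at hw
      rw [hw, map_zero, eq_comm, map_eq_zero_iff _ toLists_injective] at h
      exact h
    have hrank : Module.finrank ℤ (cycles (Set.Ioo ⊥ X) (k + 1)) = (μ ⊥ X).natAbs := by
      rw [neg_one_pow_mul_finrank_cycles hsemimod (n := k + 1) hμ0 hμ (by rw [← hk]; norm_cast),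
        Int.natAbs_mul, Int.natAbs_pow]
      simp
    have e : cycles (Set.Ioo ⊥ X) (k + 1) ≃ₗ[ℤ] (Fin (μ ⊥ X).natAbs → ℤ) :=
      LinearEquiv.ofFinrankEq _ _ (by rw [hrank, Module.finrank_fin_fun])
    exact ⟨((HredEquivCyc hbdr).trans ((cycEquiv X k).trans e).toAddEquiv).toIntLinearEquiv⟩
  · have hrank : (μ ⊥ X).natAbs = 1 := by
      rw [neg_one_pow_mul_finrank_cycles hsemimod (n := 0) hμ0 hμ (by rw [h1]; simp),
        finrank_cycles_zero]
      simp
    have hrange : LinearMap.range (augOC X) = ⊥ := by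
      rw [LinearMap.range_eq_bot]
      refine Ch.hom_ext fun f => ?_
      have := length_add_one_le_height hX (l := [f.val 0]) (List.pairwise_singleton _ _)
        (by simpa using f.prop.2 0)
      rw [h1] at this
      norm_num at this
    rw [hrank]
    exact ⟨(Submodule.quotEquivOfEqBot _ hrange).toAddEquiv.trans
      (LinearEquiv.funUnique (Fin 1) ℤ ℤ).symm.toAddEquiv⟩
  · have hlt : 1 < Order.height X := by
      refine lt_of_le_of_ne ?_ h1.symm
      rw [Order.one_le_iff_pos]
      exact Order.height_pos_of_bot_lt (bot_lt_iff_ne_bot.2 hX)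
    obtain ⟨x, z, hzx, hxX⟩ := Order.one_lt_height_iff.1 hlt
    have hsurj : LinearMap.range (augOC X) = ⊤ := by
      rw [LinearMap.range_eq_top]
      intro m
      let f : OC X 0 := ⟨fun _ => x, Subsingleton.strictMono (α := Fin 1) _, fun _ => ⟨bot_le.trans_lt hzx, hxX⟩⟩
      exact ⟨m • simplex f, by rw [map_smul, augOC_simplex, smul_eq_mul, mul_one]⟩
    exact Submodule.Quotient.subsingleton_iff.2 hsurj
end
end

section
/- Let 𝒜 be a real c-arrangement with c ≥ 2 (all subspaces have codimension c and every intersection has codimension divisible by c). Then the reduced integral cohomology of the complement M(𝒜) vanishes in degree k unless c - 1 divides k. -/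
noncomputable section

open CategoryTheory Opposite

/-- Singular `k`-simplices of a topological space. -/
def Sing (X : TopCat) (k : ℕ) : Type :=
  (TopCat.toSSet.obj X).obj (op (SimplexCategory.mk k))

/-- The `i`-th face of a singular `(k+1)`-simplex. -/
def faceS (X : TopCat) {k : ℕ} (i : Fin (k + 2)) (s : Sing X (k + 1)) : Sing X k :=
  (TopCat.toSSet.obj X).map (SimplexCategory.δ i).op s

/-- Singular `k`-cochains with integer coefficients. -/
def Cochain (X : TopCat) (k : ℕ) : Type := Sing X k → ℤ

instance (X : TopCat) (k : ℕ) : AddCommGroup (Cochain X k) := Pi.addCommGroup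
instance (X : TopCat) (k : ℕ) : Module ℤ (Cochain X k) := Pi.module _ _ _

/-- The singular coboundary map. -/
def cob (X : TopCat) (k : ℕ) : Cochain X k →ₗ[ℤ] Cochain X (k + 1) where
  toFun φ := fun s => ∑ i : Fin (k + 2), (-1 : ℤ) ^ (i : ℕ) * φ (faceS X i s)
  map_add' := by
    intro a b; funext s
    show (∑ i : Fin (k + 2), (-1 : ℤ) ^ (i : ℕ) * (a (faceS X i s) + b (faceS X i s))) = _
    simp [mul_add, Finset.sum_add_distrib]; rfl
  map_smul' := by
    intro c a; funext s
    show (∑ i : Fin (k + 2), (-1 : ℤ) ^ (i : ℕ) * (c * a (faceS X i s))) = _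
    show _ = c * ∑ i : Fin (k + 2), (-1 : ℤ) ^ (i : ℕ) * a (faceS X i s)
    rw [Finset.mul_sum]
    exact Finset.sum_congr rfl fun i _ => by ring

/-- Coboundaries in degree `k`, augmented in degree `0` by the constant functions (so that the
resulting cohomology is *reduced*). -/
def prevB (X : TopCat) : (k : ℕ) → Submodule ℤ (Cochain X k)
  | 0 => Submodule.span ℤ {(fun _ => (1 : ℤ) : Cochain X 0)}
  | (k + 1) => LinearMap.range (cob X k)

/-- The `k`-th reduced singular cohomology with `ℤ` coefficients. -/
def HredT (X : TopCat) (k : ℕ) : Type :=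
  ↥(LinearMap.ker (cob X k)) ⧸
    Submodule.comap (LinearMap.ker (cob X k)).subtype (prevB X k ⊓ LinearMap.ker (cob X k))

namespace CArr

/-! ### Ordered chains on a type -/

/-- Formal sums of `m`-tuples of points of `K`, i.e. augmented ordered chains of degree `m - 1`. -/
abbrev LC (K : Type) (m : ℕ) : Type := (Fin m → K) →₀ ℤ

section OrderedChains

variable {K K' L L' : Type}

/-- The boundary of an ordered chain. -/
def bd (m : ℕ) : LC K (m + 1) →ₗ[ℤ] LC K m :=
  Finsupp.linearCombination ℤ fun v =>
    ∑ i : Fin (m + 1), (-1 : ℤ) ^ (i : ℕ) • Finsupp.single (v ∘ i.succAbove) (1 : ℤ)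

/-- Prepending the point `b` to every tuple. -/
def cone (b : K) (m : ℕ) : LC K m →ₗ[ℤ] LC K (m + 1) :=
  Finsupp.lmapDomain ℤ ℤ fun v => (Fin.cons b v : Fin (m + 1) → K)

/-- Applying a map to every entry. -/
def mp (A : K → K') (m : ℕ) : LC K m →ₗ[ℤ] LC K' m :=
  Finsupp.lmapDomain ℤ ℤ fun v => A ∘ v

lemma bd_single (m : ℕ) (v : Fin (m + 1) → K) :
    bd m (Finsupp.single v 1) =
      ∑ i : Fin (m + 1), (-1 : ℤ) ^ (i : ℕ) • Finsupp.single (v ∘ i.succAbove) (1 : ℤ) := by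
  simp [bd]

lemma cone_single (b : K) (m : ℕ) (v : Fin m → K) (n : ℤ) :
    cone b m (Finsupp.single v n) = Finsupp.single (Fin.cons b v : Fin (m + 1) → K) n := by
  simp [cone]

lemma mp_single (A : K → K') (m : ℕ) (v : Fin m → K) (n : ℤ) :
    mp A m (Finsupp.single v n) = Finsupp.single (A ∘ v) n := by
  simp [mp]

lemma bd_cone_zero (b : K) (x : LC K 0) : bd 0 (cone b 0 x) = x := by
  suffices h : bd 0 ∘ₗ cone b 0 = LinearMap.id from LinearMap.congr_fun h x
  refine Finsupp.lhom_ext' fun v => LinearMap.ext_ring ?_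
  simp only [LinearMap.comp_apply, Finsupp.lsingle_apply, LinearMap.id_apply]
  rw [cone_single, bd_single]
  simp [Subsingleton.elim _ v]

lemma bd_cone_succ (b : K) (m : ℕ) (x : LC K (m + 1)) :
    bd (m + 1) (cone b (m + 1) x) = x - cone b m (bd m x) := by
  suffices h : bd (m + 1) ∘ₗ cone b (m + 1) = LinearMap.id - cone b m ∘ₗ bd m from
    LinearMap.congr_fun h x
  refine Finsupp.lhom_ext' fun v => LinearMap.ext_ring ?_
  simp only [LinearMap.comp_apply, Finsupp.lsingle_apply, LinearMap.id_apply, LinearMap.sub_apply]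
  rw [cone_single, bd_single, bd_single, Fin.sum_univ_succ, map_sum, sub_eq_add_neg,
    ← Finset.sum_neg_distrib]
  congr 1
  · simp only [Fin.val_zero, pow_zero, one_smul]
    congr 1
  · refine Finset.sum_congr rfl fun i _ => ?_
    rw [map_zsmul, cone_single, Fin.val_succ, pow_succ, mul_neg_one, neg_smul]
    congr 3
    funext j
    refine Fin.cases ?_ (fun j => ?_) j <;> simp [Fin.succ_succAbove_succ]

lemma bd_bd : ∀ (m : ℕ) (x : LC K (m + 2)), bd m (bd (m + 1) x) = 0
  | m, x => by
    suffices h : bd m ∘ₗ bd (m + 1) = (0 : LC K (m + 2) →ₗ[ℤ] LC K m) from LinearMap.congr_fun h x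
    refine Finsupp.lhom_ext' fun v => LinearMap.ext_ring ?_
    simp only [LinearMap.comp_apply, Finsupp.lsingle_apply, LinearMap.zero_apply]
    rw [← Fin.cons_self_tail v, ← cone_single, bd_cone_succ, map_sub]
    cases m with
    | zero => rw [bd_cone_zero, sub_self]
    | succ m => rw [bd_cone_succ, bd_bd m, map_zero, sub_zero, sub_self]

lemma mp_bd (A : K → K') (m : ℕ) (x : LC K (m + 1)) : mp A m (bd m x) = bd m (mp A (m + 1) x) := by
  suffices h : mp A m ∘ₗ bd m = bd m ∘ₗ mp A (m + 1) from LinearMap.congr_fun h x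
  refine Finsupp.lhom_ext' fun v => LinearMap.ext_ring ?_
  simp only [LinearMap.comp_apply, Finsupp.lsingle_apply]
  rw [mp_single, bd_single, bd_single, map_sum]
  exact Finset.sum_congr rfl fun i _ => by rw [map_zsmul, mp_single]; rfl

lemma mp_cone (A : K → K') (b : K) (m : ℕ) (x : LC K m) :
    mp A (m + 1) (cone b m x) = cone (A b) m (mp A m x) := by
  suffices h : mp A (m + 1) ∘ₗ cone b m = cone (A b) m ∘ₗ mp A m from LinearMap.congr_fun h x
  refine Finsupp.lhom_ext' fun v => LinearMap.ext_ring ?_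
  simp only [LinearMap.comp_apply, Finsupp.lsingle_apply]
  rw [mp_single, cone_single, cone_single, mp_single]
  congr 1
  funext j
  refine Fin.cases ?_ (fun j => ?_) j <;> simp

/-- The chain map obtained by coning off boundaries at the points `a v`. -/
def sd (a : ∀ m, (Fin (m + 1) → K) → K) : ∀ m, LC K m →ₗ[ℤ] LC K m
  | 0 => LinearMap.id
  | m + 1 => Finsupp.linearCombination ℤ fun v =>
      cone (a m v) m (sd a m (bd m (Finsupp.single v 1)))

/-- The chain homotopy between two chain maps obtained by coning at the points `a v`. -/
def hpty (F G : ∀ m, LC K m →ₗ[ℤ] LC K' m) (a : ∀ m, (Fin (m + 1) → K) → K') :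
    ∀ m, LC K m →ₗ[ℤ] LC K' (m + 1)
  | 0 => 0
  | m + 1 => Finsupp.linearCombination ℤ fun v =>
      cone (a m v) (m + 1) (F (m + 1) (Finsupp.single v 1) - G (m + 1) (Finsupp.single v 1) -
        hpty F G a m (bd m (Finsupp.single v 1)))

lemma sd_single (a : ∀ m, (Fin (m + 1) → K) → K) (m : ℕ) (v : Fin (m + 1) → K) :
    sd a (m + 1) (Finsupp.single v 1) =
      cone (a m v) m (sd a m (bd m (Finsupp.single v 1))) := by
  simp [sd]

lemma hpty_single (F G : ∀ m, LC K m →ₗ[ℤ] LC K' m) (a : ∀ m, (Fin (m + 1) → K) → K') (m : ℕ)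
    (v : Fin (m + 1) → K) :
    hpty F G a (m + 1) (Finsupp.single v 1) =
      cone (a m v) (m + 1) (F (m + 1) (Finsupp.single v 1) - G (m + 1) (Finsupp.single v 1) -
        hpty F G a m (bd m (Finsupp.single v 1))) := by
  simp [hpty]

lemma bd_sd (a : ∀ m, (Fin (m + 1) → K) → K) :
    ∀ (m : ℕ) (x : LC K (m + 1)), bd m (sd a (m + 1) x) = sd a m (bd m x)
  | m, x => by
    suffices h : bd m ∘ₗ sd a (m + 1) = sd a m ∘ₗ bd m from LinearMap.congr_fun h x
    refine Finsupp.lhom_ext' fun v => LinearMap.ext_ring ?_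
    simp only [LinearMap.comp_apply, Finsupp.lsingle_apply]
    rw [sd_single]
    cases m with
    | zero => rw [bd_cone_zero]
    | succ m => rw [bd_cone_succ, bd_sd a m, bd_bd, map_zero, map_zero, sub_zero]

lemma bd_hpty_zero (F G : ∀ m, LC K m →ₗ[ℤ] LC K' m) (a : ∀ m, (Fin (m + 1) → K) → K')
    (x : LC K 0) : bd 0 (hpty F G a 0 x) = 0 := by
  simp [hpty]

lemma bd_hpty_succ (F G : ∀ m, LC K m →ₗ[ℤ] LC K' m) (a : ∀ m, (Fin (m + 1) → K) → K')
    (hF : ∀ m x, bd m (F (m + 1) x) = F m (bd m x))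
    (hG : ∀ m x, bd m (G (m + 1) x) = G m (bd m x)) (h0 : F 0 = G 0) :
    ∀ (m : ℕ) (x : LC K (m + 1)), bd (m + 1) (hpty F G a (m + 1) x) =
      F (m + 1) x - G (m + 1) x - hpty F G a m (bd m x)
  | m, x => by
    suffices h : bd (m + 1) ∘ₗ hpty F G a (m + 1) =
        F (m + 1) - G (m + 1) - hpty F G a m ∘ₗ bd m from LinearMap.congr_fun h x
    refine Finsupp.lhom_ext' fun v => LinearMap.ext_ring ?_
    simp only [LinearMap.comp_apply, Finsupp.lsingle_apply, LinearMap.sub_apply]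
    rw [hpty_single, bd_cone_succ]
    have key : bd m (hpty F G a m (bd m (Finsupp.single v 1))) =
        F m (bd m (Finsupp.single v 1)) - G m (bd m (Finsupp.single v 1)) := by
      cases m with
      | zero => rw [bd_hpty_zero, h0, sub_self]
      | succ m => rw [bd_hpty_succ F G a hF hG h0 m, bd_bd, map_zero, sub_zero]
    rw [map_sub (bd m), map_sub (bd m), hF, hG, key, sub_self, map_zero, sub_zero]

lemma mp_sd (A : K → L) (a : ∀ m, (Fin (m + 1) → K) → K) (a' : ∀ m, (Fin (m + 1) → L) → L)
    (ha : ∀ m v, A (a m v) = a' m (A ∘ v)) :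
    ∀ (m : ℕ) (x : LC K m), mp A m (sd a m x) = sd a' m (mp A m x)
  | 0, x => rfl
  | m + 1, x => by
    suffices h : mp A (m + 1) ∘ₗ sd a (m + 1) = sd a' (m + 1) ∘ₗ mp A (m + 1) from
      LinearMap.congr_fun h x
    refine Finsupp.lhom_ext' fun v => LinearMap.ext_ring ?_
    simp only [LinearMap.comp_apply, Finsupp.lsingle_apply]
    rw [sd_single, mp_cone, mp_sd A a a' ha m, mp_single, sd_single, mp_bd, mp_single, ha]

lemma mp_hpty (A : K → L) (A' : K' → L') (F G : ∀ m, LC K m →ₗ[ℤ] LC K' m)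
    (F' G' : ∀ m, LC L m →ₗ[ℤ] LC L' m) (a : ∀ m, (Fin (m + 1) → K) → K')
    (a' : ∀ m, (Fin (m + 1) → L) → L') (ha : ∀ m v, A' (a m v) = a' m (A ∘ v))
    (hF : ∀ m x, mp A' m (F m x) = F' m (mp A m x))
    (hG : ∀ m x, mp A' m (G m x) = G' m (mp A m x)) :
    ∀ (m : ℕ) (x : LC K m), mp A' (m + 1) (hpty F G a m x) = hpty F' G' a' m (mp A m x)
  | 0, x => by simp [hpty]
  | m + 1, x => by
    suffices h : mp A' (m + 2) ∘ₗ hpty F G a (m + 1) = hpty F' G' a' (m + 1) ∘ₗ mp A (m + 1) from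
      LinearMap.congr_fun h x
    refine Finsupp.lhom_ext' fun v => LinearMap.ext_ring ?_
    simp only [LinearMap.comp_apply, Finsupp.lsingle_apply]
    rw [hpty_single, mp_cone, map_sub (mp A' (m + 1)), map_sub (mp A' (m + 1)), mp_hpty A A' F G F' G' a a' ha hF hG m, hF, hG,
      mp_bd, mp_single, hpty_single, ha]

/-- Chains all of whose tuples satisfy `P`. -/
def supp {m : ℕ} (P : (Fin m → K) → Prop) : Submodule ℤ (LC K m) :=
  Finsupp.supported ℤ ℤ {v | P v}

lemma single_mem_supp {m : ℕ} {P : (Fin m → K) → Prop} {v : Fin m → K} (hv : P v) :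
    Finsupp.single v (1 : ℤ) ∈ supp P :=
  Finsupp.single_mem_supported _ _ hv

lemma map_mem_of_supp {m : ℕ} {M : Type*} [AddCommGroup M] {P : (Fin m → K) → Prop}
    {N : Submodule ℤ M} (f : LC K m →ₗ[ℤ] M) (hf : ∀ v, P v → f (Finsupp.single v 1) ∈ N)
    {x : LC K m} (hx : x ∈ supp P) : f x ∈ N := by
  rw [supp, Finsupp.supported_eq_span_single] at hx
  have : Submodule.span ℤ ((fun v => Finsupp.single v (1 : ℤ)) '' {v | P v}) ≤ N.comap f := by
    rw [Submodule.span_le]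
    rintro _ ⟨v, hv, rfl⟩
    exact hf v hv
  exact this hx

lemma bd_mem_supp {m : ℕ} {P : (Fin (m + 1) → K) → Prop} {Q : (Fin m → K) → Prop}
    (h : ∀ v, P v → ∀ i : Fin (m + 1), Q (v ∘ i.succAbove)) {x : LC K (m + 1)} (hx : x ∈ supp P) :
    bd m x ∈ supp Q := by
  refine map_mem_of_supp _ (fun v hv => ?_) hx
  rw [bd_single]
  exact Submodule.sum_mem _ fun i _ => Submodule.smul_mem _ _ (single_mem_supp (h v hv i))

lemma cone_mem_supp {m : ℕ} {P : (Fin m → K) → Prop} {Q : (Fin (m + 1) → K) → Prop} (b : K)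
    (h : ∀ v, P v → Q (Fin.cons b v)) {x : LC K m} (hx : x ∈ supp P) : cone b m x ∈ supp Q := by
  refine map_mem_of_supp _ (fun v hv => ?_) hx
  rw [cone_single]
  exact single_mem_supp (h v hv)

lemma sd_mem_supp (a : ∀ m, (Fin (m + 1) → K) → K) {C : Set K}
    (ha : ∀ m v, (∀ i, v i ∈ C) → a m v ∈ C) :
    ∀ (m : ℕ) {x : LC K m}, x ∈ supp (fun v => ∀ i, v i ∈ C) →
      sd a m x ∈ supp (fun v => ∀ i, v i ∈ C)
  | 0, x, hx => hx
  | m + 1, x, hx => by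
    refine map_mem_of_supp _ (fun v hv => ?_) hx
    rw [sd_single]
    have hv' := single_mem_supp (P := fun v : Fin (m + 1) → K => ∀ i, v i ∈ C) hv
    refine cone_mem_supp _ (fun w hw i => ?_)
      (sd_mem_supp a ha m (bd_mem_supp (fun w hw i j => hw _) hv'))
    refine Fin.cases ?_ (fun j => ?_) i
    · exact ha m v hv
    · exact hw j

lemma hpty_mem_supp (F G : ∀ m, LC K m →ₗ[ℤ] LC K' m) (a : ∀ m, (Fin (m + 1) → K) → K')
    {C : Set K} {C' : Set K'} (ha : ∀ m v, (∀ i, v i ∈ C) → a m v ∈ C')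
    (hF : ∀ m x, x ∈ supp (fun v => ∀ i, v i ∈ C) → F m x ∈ supp (fun v => ∀ i, v i ∈ C'))
    (hG : ∀ m x, x ∈ supp (fun v => ∀ i, v i ∈ C) → G m x ∈ supp (fun v => ∀ i, v i ∈ C')) :
    ∀ (m : ℕ) {x : LC K m}, x ∈ supp (fun v => ∀ i, v i ∈ C) →
      hpty F G a m x ∈ supp (fun v => ∀ i, v i ∈ C')
  | 0, x, hx => Submodule.zero_mem _
  | m + 1, x, hx => by
    refine map_mem_of_supp _ (fun v hv => ?_) hx
    rw [hpty_single]
    have hv' := single_mem_supp (P := fun v : Fin (m + 1) → K => ∀ i, v i ∈ C) hv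
    refine cone_mem_supp _ (fun w hw i => ?_) (Submodule.sub_mem _
      (Submodule.sub_mem _ (hF _ _ hv') (hG _ _ hv'))
      (hpty_mem_supp F G a ha hF hG m (bd_mem_supp (fun w hw i j => hw _) hv')))
    refine Fin.cases ?_ (fun j => ?_) i
    · exact ha m v hv
    · exact hw j

end OrderedChains

section Convexity

variable {V W : Type} [NormedAddCommGroup V] [NormedSpace ℝ V] [NormedAddCommGroup W]
  [NormedSpace ℝ W]

/-- Convex sets, as a class so that convex combinations of their points can be formed. -/
class Cvx (S : Set V) : Prop where
  convex : Convex ℝ S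

/-- The standard simplex of dimension `k`. -/
abbrev Dl (k : ℕ) : Set (Fin (k + 1) → ℝ) := stdSimplex ℝ (Fin (k + 1))

instance (k : ℕ) : Cvx (Dl k) := ⟨convex_stdSimplex ℝ _⟩

instance (k : ℕ) : Cvx (Dl k ×ˢ Set.Icc (0 : ℝ) 1) :=
  ⟨(convex_stdSimplex ℝ _).prod (convex_Icc 0 1)⟩

/-- The convex combination of the points `w i` with weights `t i`. -/
def comb {S : Set V} [Cvx S] {m : ℕ} (w : Fin (m + 1) → S) (t : Dl m) : S :=
  ⟨∑ i, t.1 i • (w i : V), Cvx.convex.sum_mem (fun i _ => t.2.1 i) t.2.2 fun i _ => (w i).2⟩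

lemma comb_coe {S : Set V} [Cvx S] {m : ℕ} (w : Fin (m + 1) → S) (t : Dl m) :
    (comb w t : V) = ∑ i, t.1 i • (w i : V) := rfl

lemma continuous_comb {S : Set V} [Cvx S] {m : ℕ} (w : Fin (m + 1) → S) : Continuous (comb w) := by
  refine Continuous.subtype_mk ?_ _
  refine continuous_finsetSum _ fun i _ => ?_
  exact ((continuous_apply i).comp continuous_subtype_val).smul continuous_const

/-- The barycenter of a tuple. -/
def bary {S : Set V} [Cvx S] (m : ℕ) (w : Fin (m + 1) → S) : S := comb w stdSimplex.barycenter

/-- Maps preserving convex combinations. -/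
def Aff {S : Set V} {T : Set W} [Cvx S] [Cvx T] (A : S → T) : Prop :=
  ∀ (m : ℕ) (w : Fin (m + 1) → S) (t : Dl m), A (comb w t) = comb (A ∘ w) t

/-- Sets stable under convex combinations. -/
def CC {S : Set V} [Cvx S] (C : Set S) : Prop :=
  ∀ (m : ℕ) (w : Fin (m + 1) → S) (t : Dl m), (∀ i, w i ∈ C) → comb w t ∈ C

lemma CC_closedBall {S : Set V} [Cvx S] (p : S) (r : ℝ) : CC (Metric.closedBall p r) := by
  intro m w t h
  exact (convex_closedBall (p : V) r).sum_mem (fun i _ => t.2.1 i) t.2.2 fun i _ => h i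

lemma CC_ball {S : Set V} [Cvx S] (p : S) (r : ℝ) : CC (Metric.ball p r) := by
  intro m w t h
  exact (convex_ball (p : V) r).sum_mem (fun i _ => t.2.1 i) t.2.2 fun i _ => h i

lemma comb_map {S : Set V} [Cvx S] {m n : ℕ} (f : Fin (m + 1) → Fin (n + 1))
    (w : Fin (n + 1) → S) (t : Dl m) : comb w (stdSimplex.map f t) = comb (w ∘ f) t := by
  apply Subtype.ext
  rw [comb_coe, comb_coe]
  have h : ∀ i, (stdSimplex.map f t).1 i = ∑ j with f j = i, t.1 j := fun i => by
    change FunOnFinite.linearMap ℝ ℝ f t.1 i = _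
    rw [FunOnFinite.linearMap_apply_apply]
  simp only [h, Finset.sum_smul]
  rw [← Finset.sum_fiberwise Finset.univ f]
  refine Finset.sum_congr rfl fun i _ => Finset.sum_congr rfl fun j hj => ?_
  rw [Function.comp_apply, (Finset.mem_filter.1 hj).2]

lemma aff_map {m n : ℕ} (f : Fin (m + 1) → Fin (n + 1)) :
    Aff (S := Dl m) (T := Dl n) (stdSimplex.map f) := by
  intro k w t
  apply Subtype.ext
  change FunOnFinite.linearMap ℝ ℝ f (∑ i, t.1 i • (w i).1) = ∑ i, t.1 i • FunOnFinite.linearMap ℝ ℝ f (w i).1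
  simp

lemma comb_vertex {m : ℕ} (t : Dl m) :
    comb (S := Dl m) (fun i => stdSimplex.vertex i) t = t := by
  apply Subtype.ext
  rw [comb_coe]
  funext j
  simp [Finset.sum_apply, Pi.single_apply]

lemma dist_bary_le {S : Set V} [Cvx S] (m : ℕ) (w : Fin (m + 1) → S) (δ : ℝ)
    (h : ∀ i j, dist (w i) (w j) ≤ δ) (i : Fin (m + 1)) :
    dist (w i) (bary m w) ≤ m / (m + 1) * δ := by
  have e : ((w i : V) - (bary m w : V)) = ((m : ℝ) + 1)⁻¹ • ∑ j, ((w i : V) - (w j : V)) := by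
    have : (bary m w : V) = ∑ j, ((m : ℝ) + 1)⁻¹ • (w j : V) := by
      rw [bary, comb_coe]; simp
    rw [this, ← Finset.smul_sum, Finset.sum_sub_distrib, smul_sub]
    congr 1
    rw [Finset.sum_const, Finset.card_univ, Fintype.card_fin, ← Nat.cast_smul_eq_nsmul ℝ, smul_smul]
    rw [Nat.cast_succ, inv_mul_cancel₀ (by positivity), one_smul]
  rw [Subtype.dist_eq, dist_eq_norm, e, norm_smul, Real.norm_of_nonneg (by positivity)]
  have hs : ‖∑ j, ((w i : V) - (w j : V))‖ ≤ m * δ := by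
    rw [Fin.sum_univ_succAbove _ i, sub_self, zero_add]
    refine (norm_sum_le_of_le _ (f := fun j => (w i : V) - (w (i.succAbove j) : V))
      (n := fun _ => δ) fun j _ => ?_).trans (by simp)
    rw [← dist_eq_norm]
    exact h _ _
  rw [div_eq_inv_mul, mul_assoc]
  gcongr

lemma supp_and {K : Type} {m : ℕ} {P Q : (Fin m → K) → Prop} {x : LC K m} (hP : x ∈ supp P)
    (hQ : x ∈ supp Q) : x ∈ supp (fun v => P v ∧ Q v) := fun _ hv => ⟨hP hv, hQ hv⟩

lemma sd_dist {S : Set V} [Cvx S] (M : ℕ) : ∀ m ≤ M + 1, ∀ δ : ℝ, 0 ≤ δ → ∀ x : LC S m,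
    x ∈ supp (fun w => ∀ i j, dist (w i) (w j) ≤ δ) →
    sd bary m x ∈ supp (fun w => ∀ i j, dist (w i) (w j) ≤ M / (M + 1) * δ)
  | 0, _, δ, _, x, _ => fun _ _ i => i.elim0
  | m + 1, hm, δ, hδ, x, hx => by
    refine map_mem_of_supp _ (fun v hv => ?_) hx
    rw [sd_single]
    have hmM : (m : ℝ) / (m + 1) * δ ≤ M / (M + 1) * δ := by
      have : (m : ℝ) ≤ M := by exact_mod_cast Nat.le_of_succ_le_succ hm
      gcongr ?_ * δ
      rw [div_le_div_iff₀ (by positivity) (by positivity)]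
      nlinarith
    have h1 : sd bary m (bd m (Finsupp.single v 1)) ∈
        supp (fun w => ∀ i j, dist (w i) (w j) ≤ M / (M + 1) * δ) :=
      sd_dist M m (by omega) δ hδ _ (bd_mem_supp (P := fun w => ∀ i j, dist (w i) (w j) ≤ δ)
        (fun w hw i a b => hw _ _) (single_mem_supp hv))
    have h2 : sd bary m (bd m (Finsupp.single v 1)) ∈
        supp (fun w => ∀ i, w i ∈ Metric.closedBall (bary m v) (m / (m + 1) * δ)) := by
      refine sd_mem_supp bary (fun k w hw => CC_closedBall _ _ _ _ _ hw) m ?_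
      refine bd_mem_supp (P := fun w => ∀ i, w i ∈ Metric.closedBall (bary m v) (m / (m + 1) * δ))
        (fun w hw i j => hw _) (single_mem_supp fun i => dist_bary_le m v δ hv i)
    refine cone_mem_supp _ (fun w hw i j => ?_) (supp_and h1 h2)
    have hb : ∀ j, dist (w j) (bary m v) ≤ M / (M + 1) * δ := fun j => (hw.2 j).trans hmM
    refine Fin.cases ?_ (fun i => ?_) i <;> refine Fin.cases ?_ (fun j => ?_) j
    · simp only [dist_self]; positivity
    · simpa [dist_comm] using hb j
    · simpa using hb i
    · simpa using hw.1 i j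

end Convexity

section Singular

variable {E F : Type} [TopologicalSpace E]

/-- Singular simplices. -/
abbrev Sx (E : Type) [TopologicalSpace E] (k : ℕ) : Type := C(Dl k, E)

/-- The faces of a singular simplex. -/
def face {k : ℕ} (i : Fin (k + 2)) (s : Sx E (k + 1)) : Sx E k :=
  s.comp ⟨stdSimplex.map i.succAbove, stdSimplex.continuous_map _⟩

/-- Singular chains. -/
abbrev SC (E : Type) [TopologicalSpace E] (k : ℕ) : Type := Sx E k →₀ ℤ

/-- The singular boundary. -/
def dS (k : ℕ) : SC E (k + 1) →ₗ[ℤ] SC E k :=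
  Finsupp.linearCombination ℤ fun s =>
    ∑ i : Fin (k + 2), (-1 : ℤ) ^ (i : ℕ) • Finsupp.single (face i s) (1 : ℤ)

lemma dS_single (k : ℕ) (s : Sx E (k + 1)) : dS k (Finsupp.single s 1) =
    ∑ i : Fin (k + 2), (-1 : ℤ) ^ (i : ℕ) • Finsupp.single (face i s) (1 : ℤ) := by
  simp [dS]

variable {V W : Type} [NormedAddCommGroup V] [NormedSpace ℝ V] [NormedAddCommGroup W]
  [NormedSpace ℝ W] {S : Set V} [Cvx S] {T : Set W} [Cvx T]

/-- The singular simplex given by an affine simplex followed by `σ`. -/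
def aff (σ : C(S, E)) {k : ℕ} (w : Fin (k + 1) → S) : Sx E k := σ.comp ⟨comb w, continuous_comb w⟩

/-- The singular chain given by an ordered chain followed by `σ`. -/
def push (σ : C(S, E)) (k : ℕ) : LC S (k + 1) →ₗ[ℤ] SC E k :=
  Finsupp.lmapDomain ℤ ℤ fun w => aff σ w

lemma push_single (σ : C(S, E)) (k : ℕ) (w : Fin (k + 1) → S) (n : ℤ) :
    push σ k (Finsupp.single w n) = Finsupp.single (aff σ w) n := by
  simp [push]

lemma push_bd (σ : C(S, E)) (k : ℕ) (x : LC S (k + 2)) :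
    dS k (push σ (k + 1) x) = push σ k (bd (k + 1) x) := by
  suffices h : dS k ∘ₗ push σ (k + 1) = push σ k ∘ₗ bd (k + 1) from LinearMap.congr_fun h x
  refine Finsupp.lhom_ext' fun w => LinearMap.ext_ring ?_
  simp only [LinearMap.comp_apply, Finsupp.lsingle_apply]
  rw [push_single, dS_single, bd_single, map_sum]
  refine Finset.sum_congr rfl fun i _ => ?_
  rw [map_zsmul, push_single]
  congr 2
  ext t
  exact congrArg σ (comb_map _ _ _)

lemma push_comp (σ : C(T, E)) (A : C(S, T)) (hA : Aff A) (k : ℕ) (x : LC S (k + 1)) :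
    push (σ.comp A) k x = push σ k (mp A (k + 1) x) := by
  suffices h : push (σ.comp A) k = push σ k ∘ₗ mp A (k + 1) from LinearMap.congr_fun h x
  refine Finsupp.lhom_ext' fun w => LinearMap.ext_ring ?_
  simp only [LinearMap.comp_apply, Finsupp.lsingle_apply]
  rw [push_single, mp_single, push_single]
  congr 1
  ext t
  exact congrArg σ (hA _ _ _)

/-- The tautological ordered simplex. -/
def vtx (k : ℕ) : LC (Dl k) (k + 1) := Finsupp.single (fun i => stdSimplex.vertex i) 1

/-- The coface map. -/
def cof {k : ℕ} (i : Fin (k + 2)) : C(Dl k, Dl (k + 1)) :=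
  ⟨stdSimplex.map i.succAbove, stdSimplex.continuous_map _⟩

lemma push_vtx (k : ℕ) (s : Sx E k) : push s k (vtx k) = Finsupp.single s 1 := by
  rw [vtx, push_single]
  congr 1
  ext t
  exact congrArg s (comb_vertex t)

lemma bd_vtx (k : ℕ) : bd (k + 1) (vtx (k + 1)) =
    ∑ i : Fin (k + 2), (-1 : ℤ) ^ (i : ℕ) • mp (cof i) (k + 1) (vtx k) := by
  rw [vtx, bd_single]
  refine Finset.sum_congr rfl fun i _ => ?_
  rw [vtx, mp_single]
  congr 2
  funext j
  exact (stdSimplex.map_vertex _ _).symm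

/-- The chains on simplices satisfying `P`. -/
def ssupp {k : ℕ} (P : Sx E k → Prop) : Submodule ℤ (SC E k) := Finsupp.supported ℤ ℤ {s | P s}

lemma push_mem_ssupp (σ : C(S, E)) {k : ℕ} {P : (Fin (k + 1) → S) → Prop} {Q : Sx E k → Prop}
    (h : ∀ w, P w → Q (aff σ w)) {x : LC S (k + 1)} (hx : x ∈ supp P) :
    push σ k x ∈ ssupp Q := by
  refine map_mem_of_supp _ (fun v hv => ?_) hx
  rw [push_single]
  exact Finsupp.single_mem_supported _ _ (h v hv)

end Singular

section Cochains

variable {E E' : Type} [TopologicalSpace E] [TopologicalSpace E']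

/-- Evaluation of a cochain on chains. -/
def ev {k : ℕ} (φ : Sx E k → ℤ) : SC E k →ₗ[ℤ] ℤ := Finsupp.linearCombination ℤ φ

/-- The coboundary of a cochain. -/
def cb {k : ℕ} (φ : Sx E k → ℤ) : Sx E (k + 1) → ℤ :=
  fun s => ∑ i : Fin (k + 2), (-1 : ℤ) ^ (i : ℕ) * φ (face i s)

/-- The simplex `s` lies in `U`. -/
def Inn (U : Set E) {k : ℕ} (s : Sx E k) : Prop := ∀ t, s t ∈ U

/-- The cochain `φ` restricts to a cocycle on `U`. -/
def Cocyc (U : Set E) {k : ℕ} (φ : Sx E k → ℤ) : Prop := ∀ s, Inn U s → cb φ s = 0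

/-- The cochain `φ` restricts to a coboundary on `U`. -/
def Cob (U : Set E) : ∀ {k : ℕ}, (Sx E k → ℤ) → Prop
  | 0, φ => ∀ s, Inn U s → φ s = 0
  | _ + 1, φ => ∃ ψ, ∀ s, Inn U s → φ s = cb ψ s

lemma ev_single {k : ℕ} (φ : Sx E k → ℤ) (s : Sx E k) : ev φ (Finsupp.single s 1) = φ s := by
  simp [ev]

lemma ev_dS_single {k : ℕ} (φ : Sx E k → ℤ) (s : Sx E (k + 1)) :
    ev φ (dS k (Finsupp.single s 1)) = cb φ s := by
  rw [dS_single, map_sum]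
  exact Finset.sum_congr rfl fun i _ => by rw [map_zsmul, ev_single, smul_eq_mul]

lemma ev_eq_of_ssupp {k : ℕ} {P : Sx E k → Prop} {M : Type} [AddCommGroup M]
    (f g : SC E k →ₗ[ℤ] M) (h : ∀ s, P s → f (Finsupp.single s 1) = g (Finsupp.single s 1))
    {x : SC E k} (hx : x ∈ ssupp P) : f x = g x := by
  rw [ssupp, Finsupp.supported_eq_span_single] at hx
  have : Submodule.span ℤ ((fun v => Finsupp.single v (1 : ℤ)) '' {v | P v}) ≤
      LinearMap.eqLocus f g := by
    rw [Submodule.span_le]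
    rintro _ ⟨v, hv, rfl⟩
    exact h v hv
  exact this hx

lemma ev_dS_eq_zero {k : ℕ} {P : Sx E (k + 1) → Prop} (φ : Sx E k → ℤ)
    (h : ∀ s, P s → cb φ s = 0) {x : SC E (k + 1)} (hx : x ∈ ssupp P) : ev φ (dS k x) = 0 :=
  ev_eq_of_ssupp (ev φ ∘ₗ dS k) 0 (fun s hs => by
    rw [LinearMap.comp_apply, ev_dS_single, h s hs, LinearMap.zero_apply]) hx

lemma dS_dS (k : ℕ) (x : SC E (k + 2)) : dS k (dS (k + 1) x) = 0 := by
  suffices h : dS k ∘ₗ dS (k + 1) = (0 : SC E (k + 2) →ₗ[ℤ] SC E k) from LinearMap.congr_fun h x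
  refine Finsupp.lhom_ext' fun s => LinearMap.ext_ring ?_
  simp only [LinearMap.comp_apply, Finsupp.lsingle_apply, LinearMap.zero_apply]
  rw [← push_vtx, push_bd, push_bd, bd_bd, map_zero]

lemma cb_cb {k : ℕ} (φ : Sx E k → ℤ) (s : Sx E (k + 2)) : cb (cb φ) s = 0 := by
  rw [← ev_dS_single]
  have : ev (cb φ) = ev φ ∘ₗ dS k := by
    refine Finsupp.lhom_ext' fun s => LinearMap.ext_ring ?_
    simp only [LinearMap.comp_apply, Finsupp.lsingle_apply]
    rw [ev_single, ev_dS_single]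
  rw [this, LinearMap.comp_apply, dS_dS, map_zero]

lemma Inn.face {U : Set E} {k : ℕ} {s : Sx E (k + 1)} (h : Inn U s) (i : Fin (k + 2)) :
    Inn U (face i s) := fun _ => h _

lemma Inn.mono {U W : Set E} (hUW : U ⊆ W) {k : ℕ} {s : Sx E k} (h : Inn U s) : Inn W s :=
  fun t => hUW (h t)

lemma cb_add {k : ℕ} (φ ψ : Sx E k → ℤ) (s : Sx E (k + 1)) : cb (φ + ψ) s = cb φ s + cb ψ s := by
  simp [cb, mul_add, Finset.sum_add_distrib]

lemma cb_sub {k : ℕ} (φ ψ : Sx E k → ℤ) (s : Sx E (k + 1)) : cb (φ - ψ) s = cb φ s - cb ψ s := by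
  simp [cb, mul_sub, Finset.sum_sub_distrib]

lemma cb_congr {U : Set E} {k : ℕ} {φ ψ : Sx E k → ℤ} (h : ∀ s, Inn U s → φ s = ψ s)
    {s : Sx E (k + 1)} (hs : Inn U s) : cb φ s = cb ψ s :=
  Finset.sum_congr rfl fun i _ => by rw [h _ (hs.face i)]

lemma Cocyc.mono {U W : Set E} (hUW : U ⊆ W) {k : ℕ} {φ : Sx E k → ℤ} (h : Cocyc W φ) :
    Cocyc U φ := fun s hs => h s (hs.mono hUW)

lemma Cob.mono {U W : Set E} (hUW : U ⊆ W) : ∀ {k : ℕ} {φ : Sx E k → ℤ}, Cob W φ → Cob U φ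
  | 0, _, h => fun s hs => h s (hs.mono hUW)
  | _ + 1, _, ⟨ψ, h⟩ => ⟨ψ, fun s hs => h s (hs.mono hUW)⟩

lemma Cob.add {U : Set E} : ∀ {k : ℕ} {φ φ' : Sx E k → ℤ}, Cob U φ → Cob U φ' → Cob U (φ + φ')
  | 0, _, _, h, h' => fun s hs => by rw [Pi.add_apply, h s hs, h' s hs, add_zero]
  | _ + 1, _, _, ⟨ψ, h⟩, ⟨ψ', h'⟩ => ⟨ψ + ψ', fun s hs => by
      rw [Pi.add_apply, h s hs, h' s hs, cb_add]⟩

lemma Cob.sub {U : Set E} : ∀ {k : ℕ} {φ φ' : Sx E k → ℤ}, Cob U φ → Cob U φ' → Cob U (φ - φ')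
  | 0, _, _, h, h' => fun s hs => by rw [Pi.sub_apply, h s hs, h' s hs, sub_zero]
  | _ + 1, _, _, ⟨ψ, h⟩, ⟨ψ', h'⟩ => ⟨ψ - ψ', fun s hs => by
      rw [Pi.sub_apply, h s hs, h' s hs, cb_sub]⟩

lemma Cocyc.sub {U : Set E} {k : ℕ} {φ φ' : Sx E k → ℤ} (h : Cocyc U φ) (h' : Cocyc U φ') :
    Cocyc U (φ - φ') := fun s hs => by rw [cb_sub, h s hs, h' s hs, sub_zero]

/-- The pullback of a cochain. -/
def pull (f : C(E, E')) {k : ℕ} (φ : Sx E' k → ℤ) : Sx E k → ℤ := fun s => φ (f.comp s)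

lemma pull_sub (f : C(E, E')) {k : ℕ} (φ ψ : Sx E' k → ℤ) :
    pull f (φ - ψ) = pull f φ - pull f ψ := rfl

lemma Cocyc.pull {U : Set E} {W : Set E'} (f : C(E, E')) (hf : Set.MapsTo f U W) {k : ℕ}
    {φ : Sx E' k → ℤ} (h : Cocyc W φ) : Cocyc U (pull f φ) :=
  fun s hs => h (f.comp s) fun t => hf (hs t)

lemma Cob.pull {U : Set E} {W : Set E'} (f : C(E, E')) (hf : Set.MapsTo f U W) :
    ∀ {k : ℕ} {φ : Sx E' k → ℤ}, Cob W φ → Cob U (pull f φ)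
  | 0, _, h => fun s hs => h (f.comp s) fun t => hf (hs t)
  | _ + 1, _, ⟨ψ, h⟩ => ⟨CArr.pull f ψ, fun s hs => h (f.comp s) fun t => hf (hs t)⟩

/-- The cohomology of `U` in degree `k` (not reduced) vanishes. -/
def HZ (U : Set E) (k : ℕ) : Prop := ∀ φ : Sx E k → ℤ, Cocyc U φ → Cob U φ

end Cochains

section Homotopy

/-- The bottom and the top of the prism. -/
def ends (k : ℕ) (b : Set.Icc (0 : ℝ) 1) : C(Dl k, (Dl k ×ˢ Set.Icc (0 : ℝ) 1 : Set _)) :=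
  ⟨fun x => ⟨(x.1, b.1), x.2, b.2⟩, by fun_prop⟩

lemma aff_ends (k : ℕ) (b : Set.Icc (0 : ℝ) 1) : Aff (ends k b) := by
  intro m w t
  apply Subtype.ext
  refine Prod.ext ?_ ?_
  · change (∑ i, t.1 i • ((w i).1)) = Prod.fst (∑ i, t.1 i • ((w i).1, b.1))
    rw [Prod.fst_sum]
    rfl
  · change b.1 = Prod.snd (∑ i, t.1 i • ((w i).1, b.1))
    rw [Prod.snd_sum]
    simp only [Prod.smul_mk, smul_eq_mul]
    rw [← Finset.sum_mul, t.2.2, one_mul]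

/-- The coface map of prisms. -/
def cofI {k : ℕ} (i : Fin (k + 2)) :
    C((Dl k ×ˢ Set.Icc (0 : ℝ) 1 : Set _), (Dl (k + 1) ×ˢ Set.Icc (0 : ℝ) 1 : Set _)) :=
  ⟨fun x => ⟨((cof i ⟨x.1.1, x.2.1⟩).1, x.1.2), (cof i ⟨x.1.1, x.2.1⟩).2, x.2.2⟩, by fun_prop⟩

lemma aff_cofI {k : ℕ} (i : Fin (k + 2)) : Aff (cofI i) := by
  intro m w t
  apply Subtype.ext
  refine Prod.ext ?_ ?_
  · change FunOnFinite.linearMap ℝ ℝ i.succAbove (Prod.fst (∑ j, t.1 j • (w j).1)) =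
      Prod.fst (∑ j, t.1 j • (cofI i (w j)).1)
    rw [Prod.fst_sum, Prod.fst_sum, map_sum]
    exact Finset.sum_congr rfl fun j _ => by simp; rfl
  · change Prod.snd (∑ j, t.1 j • (w j).1) = Prod.snd (∑ j, t.1 j • (cofI i (w j)).1)
    rw [Prod.snd_sum, Prod.snd_sum]
    rfl

/-- The prism operator on ordered chains of a simplex. -/
def prism (k m : ℕ) : LC (Dl k) m →ₗ[ℤ] LC (Dl k ×ˢ Set.Icc (0 : ℝ) 1 : Set _) (m + 1) :=
  hpty (fun m => mp (ends k 0) m) (fun m => mp (ends k 1) m) (fun _ v => ends k 0 (v 0)) m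

lemma prism_bd (k m : ℕ) (x : LC (Dl k) (m + 1)) : bd (m + 1) (prism k (m + 1) x) =
    mp (ends k 0) (m + 1) x - mp (ends k 1) (m + 1) x - prism k m (bd m x) :=
  bd_hpty_succ _ _ _ (fun m x => (mp_bd _ m x).symm) (fun m x => (mp_bd _ m x).symm)
    (by
      refine Finsupp.lhom_ext' fun v => LinearMap.ext_ring ?_
      simp only [LinearMap.comp_apply, Finsupp.lsingle_apply]
      rw [mp_single, mp_single]
      congr 1
      exact Subsingleton.elim _ _) m x

lemma mp_mp {K K' K'' : Type} (A : K → K') (B : K' → K'') (m : ℕ) (x : LC K m) :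
    mp B m (mp A m x) = mp (B ∘ A) m x := by
  suffices h : mp B m ∘ₗ mp A m = mp (B ∘ A) m from LinearMap.congr_fun h x
  refine Finsupp.lhom_ext' fun v => LinearMap.ext_ring ?_
  simp only [LinearMap.comp_apply, Finsupp.lsingle_apply]
  rw [mp_single, mp_single, mp_single]
  rfl

lemma prism_nat {k : ℕ} (i : Fin (k + 2)) (m : ℕ) (x : LC (Dl k) m) :
    mp (cofI i) (m + 1) (prism k m x) = prism (k + 1) m (mp (cof i) m x) :=
  mp_hpty _ _ _ _ _ _ _ _ (fun _ _ => rfl) (fun m x => by rw [mp_mp, mp_mp]; rfl)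
    (fun m x => by rw [mp_mp, mp_mp]; rfl) m x

variable {E E' : Type} [TopologicalSpace E] [NormedAddCommGroup E'] [NormedSpace ℝ E']

/-- The straight line homotopy from `f ∘ s` to `g ∘ s`. -/
def line (f g : C(E, E')) {k : ℕ} (s : Sx E k) : C((Dl k ×ˢ Set.Icc (0 : ℝ) 1 : Set _), E') :=
  ⟨fun x => (1 - x.1.2) • f (s ⟨x.1.1, x.2.1⟩) + x.1.2 • g (s ⟨x.1.1, x.2.1⟩), by fun_prop⟩

/-- The prism operator on singular simplices. -/
def prismS (f g : C(E, E')) {k : ℕ} (s : Sx E k) : SC E' (k + 1) :=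
  push (line f g s) (k + 1) (prism k (k + 1) (vtx k))

lemma push_line_ends (f g : C(E, E')) {k : ℕ} (s : Sx E k) :
    push (line f g s) k (mp (ends k 0) (k + 1) (vtx k)) = Finsupp.single (f.comp s) 1 ∧
    push (line f g s) k (mp (ends k 1) (k + 1) (vtx k)) = Finsupp.single (g.comp s) 1 := by
  rw [← push_comp _ _ (aff_ends k 0), ← push_comp _ _ (aff_ends k 1), push_vtx, push_vtx]
  constructor <;> congr 1 <;> ext t <;> simp [line, ends]

lemma dS_prismS_zero (f g : C(E, E')) (s : Sx E 0) :
    dS 0 (prismS f g s) = Finsupp.single (f.comp s) 1 - Finsupp.single (g.comp s) 1 := by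
  rw [prismS, push_bd, prism_bd, map_sub, map_sub, (push_line_ends f g s).1,
    (push_line_ends f g s).2]
  simp [prism, hpty]

lemma dS_prismS_succ (f g : C(E, E')) {k : ℕ} (s : Sx E (k + 1)) :
    dS (k + 1) (prismS f g s) = Finsupp.single (f.comp s) 1 - Finsupp.single (g.comp s) 1 -
      ∑ i : Fin (k + 2), (-1 : ℤ) ^ (i : ℕ) • prismS f g (face i s) := by
  rw [prismS, push_bd, prism_bd, map_sub, map_sub, (push_line_ends f g s).1,
    (push_line_ends f g s).2, bd_vtx, map_sum, map_sum]
  congr 1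
  refine Finset.sum_congr rfl fun i _ => ?_
  rw [map_zsmul, map_zsmul, ← prism_nat, ← push_comp _ _ (aff_cofI i)]
  rfl

lemma prismS_mem (f g : C(E, E')) {U : Set E} {W : Set E'}
    (h : ∀ x ∈ U, ∀ a : ℝ, 0 ≤ a → a ≤ 1 → (1 - a) • f x + a • g x ∈ W) {k : ℕ} {s : Sx E k}
    (hs : Inn U s) : prismS f g s ∈ ssupp (Inn W) := by
  refine push_mem_ssupp (P := fun _ => True) _ (fun w _ t => ?_) fun _ _ => trivial
  exact h _ (hs _) _ (comb w t).2.2.1 (comb w t).2.2.2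

lemma cob_of_line (f g : C(E, E')) {U : Set E} {W : Set E'}
    (h : ∀ x ∈ U, ∀ a : ℝ, 0 ≤ a → a ≤ 1 → (1 - a) • f x + a • g x ∈ W) :
    ∀ {k : ℕ} {φ : Sx E' k → ℤ}, Cocyc W φ → Cob U (pull f φ - pull g φ)
  | 0, φ, hφ => fun s hs => by
    have := ev_dS_eq_zero φ hφ (prismS_mem f g h hs)
    rwa [dS_prismS_zero, map_sub, ev_single, ev_single] at this
  | k + 1, φ, hφ => ⟨fun s => ev φ (prismS f g s), fun s hs => by
    have := ev_dS_eq_zero φ hφ (prismS_mem f g h hs)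
    rw [dS_prismS_succ, map_sub, map_sub, ev_single, ev_single, map_sum, sub_eq_zero] at this
    simpa [cb, pull] using this⟩

end Homotopy

section Subdivision

variable {V W : Type} [NormedAddCommGroup V] [NormedSpace ℝ V] [NormedAddCommGroup W]
  [NormedSpace ℝ W] {S : Set V} [Cvx S] {T : Set W} [Cvx T]

/-- The homotopy from the identity to the barycentric subdivision. -/
def sdH (m : ℕ) : LC S m →ₗ[ℤ] LC S (m + 1) :=
  hpty (fun _ => LinearMap.id) (fun m => sd bary m) bary m

lemma bd_sdH (m : ℕ) (x : LC S (m + 1)) :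
    bd (m + 1) (sdH (m + 1) x) = x - sd bary (m + 1) x - sdH m (bd m x) :=
  bd_hpty_succ (fun _ => LinearMap.id) (fun m => sd bary m) bary (fun _ _ => rfl)
    (fun m x => bd_sd bary m x) rfl m x

/-- The iterated barycentric subdivision. -/
def sdj (m : ℕ) : ℕ → LC S m →ₗ[ℤ] LC S m
  | 0 => LinearMap.id
  | j + 1 => sd bary m ∘ₗ sdj m j

/-- The homotopy from the identity to the iterated subdivision. -/
def sdHj (m : ℕ) : ℕ → LC S m →ₗ[ℤ] LC S (m + 1)
  | 0 => 0
  | j + 1 => sdHj m j + sdH m ∘ₗ sdj m j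

lemma bd_sdj (m : ℕ) (x : LC S (m + 1)) : ∀ j, bd m (sdj (m + 1) j x) = sdj m j (bd m x)
  | 0 => rfl
  | j + 1 => by
    simp only [sdj, LinearMap.comp_apply]
    rw [bd_sd, bd_sdj m x j]

lemma bd_sdHj (m : ℕ) (x : LC S (m + 1)) :
    ∀ j, bd (m + 1) (sdHj (m + 1) j x) = x - sdj (m + 1) j x - sdHj m j (bd m x)
  | 0 => by simp [sdj, sdHj]
  | j + 1 => by
    simp only [sdj, sdHj, LinearMap.comp_apply, LinearMap.add_apply, map_add]
    rw [bd_sdHj m x j, bd_sdH, bd_sdj]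
    abel

lemma mp_sdj (A : S → T) (hA : Aff A) (m : ℕ) (x : LC S m) :
    ∀ j, mp A m (sdj m j x) = sdj m j (mp A m x)
  | 0 => rfl
  | j + 1 => by
    simp only [sdj, LinearMap.comp_apply]
    rw [mp_sd A bary bary fun m v => hA m v _, mp_sdj A hA m x j]

lemma mp_sdHj (A : S → T) (hA : Aff A) (m : ℕ) (x : LC S m) :
    ∀ j, mp A (m + 1) (sdHj m j x) = sdHj m j (mp A m x)
  | 0 => by simp [sdHj]
  | j + 1 => by
    simp only [sdHj, LinearMap.comp_apply, LinearMap.add_apply, map_add]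
    rw [mp_sdHj A hA m x j, ← mp_sdj A hA]
    congr 1
    exact mp_hpty A A _ _ _ _ bary bary (fun m v => hA m v _) (fun _ _ => rfl)
      (fun m x => mp_sd A bary bary (fun m v => hA m v _) m x) m _

lemma sdj_dist (M : ℕ) {x : LC S (M + 1)} {δ : ℝ} (hδ : 0 ≤ δ)
    (hx : x ∈ supp (fun w => ∀ i j, dist (w i) (w j) ≤ δ)) :
    ∀ n, sdj (M + 1) n x ∈ supp (fun w => ∀ i j, dist (w i) (w j) ≤ (M / (M + 1) : ℝ) ^ n * δ)
  | 0 => by simpa [sdj] using hx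
  | n + 1 => by
    have := sd_dist M (M + 1) le_rfl _ (by positivity) _ (sdj_dist M hδ hx n)
    rwa [← mul_assoc, ← pow_succ'] at this

variable {E : Type} [TopologicalSpace E]

/-- The subdivision homotopy on a singular simplex. -/
def sdD (j : ℕ) {k : ℕ} (σ : Sx E k) : SC E (k + 1) := push σ (k + 1) (sdHj (k + 1) j (vtx k))

lemma dS_sdD (j : ℕ) {k : ℕ} (σ : Sx E (k + 1)) : dS (k + 1) (sdD j σ) =
    Finsupp.single σ 1 - push σ (k + 1) (sdj (k + 2) j (vtx (k + 1))) -
      ∑ i : Fin (k + 2), (-1 : ℤ) ^ (i : ℕ) • sdD j (face i σ) := by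
  rw [sdD, push_bd, bd_sdHj, map_sub, map_sub, push_vtx, bd_vtx, map_sum, map_sum]
  congr 1
  refine Finset.sum_congr rfl fun i _ => ?_
  rw [map_zsmul, map_zsmul, ← mp_sdHj (cof i) (aff_map _), ← push_comp _ _ (aff_map _)]
  rfl

lemma sdD_mem {U : Set E} (j : ℕ) {k : ℕ} {σ : Sx E k} (h : Inn U σ) :
    sdD j σ ∈ ssupp (Inn U) :=
  push_mem_ssupp (P := fun _ => True) _ (fun _ _ _ => h _) fun _ _ => trivial

/-- The sets `A` and `B` are relatively open in their union. -/
def Exc (A B : Set E) : Prop := ∃ A' B', IsOpen A' ∧ IsOpen B' ∧ A ⊆ A' ∧ B ⊆ B' ∧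
  (A ∪ B) ∩ A' ⊆ A ∧ (A ∪ B) ∩ B' ⊆ B

/-- The simplex `s` lies in `A` or in `B`. -/
def Small (A B : Set E) {k : ℕ} (s : Sx E k) : Prop := Inn A s ∨ Inn B s

/-- All further subdivisions of `σ` after step `m` are small. -/
def Fine (A B : Set E) {k : ℕ} (σ : Sx E k) (m : ℕ) : Prop := ∀ j ≥ m,
  push σ k (sdj (k + 1) j (vtx k)) ∈ ssupp (Small A B) ∧
  push σ (k + 1) (sdH (k + 1) (sdj (k + 1) j (vtx k))) ∈ ssupp (Small A B)

lemma dist_Dl_le {k : ℕ} (x y : Dl k) : dist x y ≤ 1 := by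
  rw [Subtype.dist_eq, dist_pi_le_iff zero_le_one]
  intro i
  have hx := mem_Icc_of_mem_stdSimplex x.2 i
  have hy := mem_Icc_of_mem_stdSimplex y.2 i
  rw [Real.dist_eq, abs_le]
  constructor <;> linarith [hx.1, hx.2, hy.1, hy.2]

lemma exists_fine {A B : Set E} (h : Exc A B) {k : ℕ} {σ : Sx E k} (hσ : Inn (A ∪ B) σ) :
    ∃ m, Fine A B σ m := by
  obtain ⟨A', B', hA', hB', hAA, hBB, hA, hB⟩ := h
  obtain ⟨δ, hδ, hball⟩ := lebesgue_number_lemma_of_metric (s := (Set.univ : Set (Dl k)))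
    (c := fun b : Bool => σ ⁻¹' (if b then A' else B')) isCompact_univ
    (by
      rintro (_ | _)
      · exact hB'.preimage σ.continuous
      · exact hA'.preimage σ.continuous)
    (by
      intro t _
      rw [Set.mem_iUnion]
      rcases hσ t with h | h
      · exact ⟨true, hAA h⟩
      · exact ⟨false, hBB h⟩)
  have hr1 : (k / (k + 1) : ℝ) < 1 := by
    rw [div_lt_one (by positivity)]
    linarith
  have hr0 : (0 : ℝ) ≤ k / (k + 1) := by positivity
  obtain ⟨m, hm⟩ := exists_pow_lt_of_lt_one hδ hr1
  refine ⟨m, fun j hj => ?_⟩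
  have hsupp : sdj (k + 1) j (vtx k) ∈ supp (fun w => ∀ i j, dist (w i) (w j) < δ) := by
    have h1 := sdj_dist k zero_le_one
      (single_mem_supp (v := fun i => (stdSimplex.vertex i : Dl k)) fun i j => dist_Dl_le _ _) j
    refine fun w hw a b => (h1 hw a b).trans_lt ?_
    rw [mul_one]
    exact (pow_le_pow_of_le_one hr0 hr1.le hj).trans_lt hm
  have key : ∀ w : Fin (k + 1) → Dl k, ∀ (n : ℕ) (v : Fin (n + 1) → Dl k),
      (∀ i, v i ∈ Metric.ball (w 0) δ) → Small A B (aff σ v) := by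
    intro w n v hv
    have hin : ∀ t, comb v t ∈ Metric.ball (w 0) δ := fun t => CC_ball _ _ _ _ _ hv
    obtain ⟨b, hb⟩ := hball (w 0) trivial
    cases b with
    | true => exact Or.inl fun t => hA ⟨hσ _, hb (hin t)⟩
    | false => exact Or.inr fun t => hB ⟨hσ _, hb (hin t)⟩
  constructor
  · exact push_mem_ssupp _ (fun w hw => key w k w fun i => hw i 0) hsupp
  · refine map_mem_of_supp (push σ (k + 1) ∘ₗ sdH (k + 1)) (fun w hw => ?_) hsupp
    refine push_mem_ssupp (P := fun v => ∀ i, v i ∈ Metric.ball (w 0) δ) σ (key w _) ?_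
    refine hpty_mem_supp _ _ _ (fun m v hv => CC_ball _ _ _ _ _ hv) (fun _ _ h => h)
      (fun m x hx => sd_mem_supp _ (fun m v hv => CC_ball _ _ _ _ _ hv) m hx) _ ?_
    exact single_mem_supp fun i => hw i 0

/-- A number of subdivisions making `σ` and its faces small. -/
def numS (A B : Set E) : ∀ {k : ℕ}, Sx E k → ℕ
  | 0, σ => sInf {m | Fine A B σ m}
  | _ + 1, σ => max (sInf {m | Fine A B σ m}) (Finset.univ.sup fun i => numS A B (face i σ))

lemma fine_numS {A B : Set E} (h : Exc A B) {k : ℕ} {σ : Sx E k} (hσ : Inn (A ∪ B) σ) :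
    Fine A B σ (numS A B σ) := by
  have h1 : Fine A B σ (sInf {m | Fine A B σ m}) := Nat.sInf_mem (exists_fine h hσ)
  have h2 : sInf {m | Fine A B σ m} ≤ numS A B σ := by
    cases k with
    | zero => exact le_rfl
    | succ k => exact le_max_left _ _
  exact fun j hj => h1 j (h2.trans hj)

lemma numS_face (A B : Set E) {k : ℕ} (σ : Sx E (k + 1)) (i : Fin (k + 2)) :
    numS A B (face i σ) ≤ numS A B σ :=
  (Finset.le_sup (f := fun i => numS A B (face i σ)) (Finset.mem_univ i)).trans (le_max_right _ _)

lemma sdD_sub_mem {A B : Set E} {k : ℕ} {σ : Sx E k} {m : ℕ} (h : Fine A B σ m) {j : ℕ}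
    (hj : m ≤ j) : sdD j σ - sdD m σ ∈ ssupp (Small A B) := by
  induction j, hj using Nat.le_induction with
  | base => rw [sub_self]; exact Submodule.zero_mem _
  | succ j hj ih =>
    have : sdD (j + 1) σ - sdD m σ = (sdD j σ - sdD m σ) +
        push σ (k + 1) (sdH (k + 1) (sdj (k + 1) j (vtx k))) := by
      simp only [sdD, sdHj, LinearMap.add_apply, map_add, LinearMap.comp_apply]
      abel
    rw [this]
    exact Submodule.add_mem _ ih (h j hj).2

/-- The homotopy from the identity to the subdivision making simplices small. -/
def smH (A B : Set E) (k : ℕ) : SC E k →ₗ[ℤ] SC E (k + 1) :=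
  Finsupp.linearCombination ℤ fun σ => sdD (numS A B σ) σ

lemma smH_single (A B : Set E) {k : ℕ} (σ : Sx E k) :
    smH A B k (Finsupp.single σ 1) = sdD (numS A B σ) σ := by
  simp [smH]

/-- The subdivision making simplices small. -/
def smR (A B : Set E) (k : ℕ) : SC E (k + 1) →ₗ[ℤ] SC E (k + 1) :=
  LinearMap.id - dS (k + 1) ∘ₗ smH A B (k + 1) - smH A B k ∘ₗ dS k

lemma smR_apply (A B : Set E) {k : ℕ} (x : SC E (k + 1)) :
    smR A B k x = x - dS (k + 1) (smH A B (k + 1) x) - smH A B k (dS k x) := rfl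

lemma smR_mem {A B : Set E} (h : Exc A B) {k : ℕ} {σ : Sx E (k + 1)} (hσ : Inn (A ∪ B) σ) :
    smR A B k (Finsupp.single σ 1) ∈ ssupp (Small A B) := by
  have : smR A B k (Finsupp.single σ 1) =
      push σ (k + 1) (sdj (k + 2) (numS A B σ) (vtx (k + 1))) +
        ∑ i : Fin (k + 2), (-1 : ℤ) ^ (i : ℕ) •
          (sdD (numS A B σ) (face i σ) - sdD (numS A B (face i σ)) (face i σ)) := by
    rw [smR_apply, smH_single, dS_sdD, dS_single, map_sum]
    simp only [map_zsmul, smH_single, smul_sub, Finset.sum_sub_distrib]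
    abel
  rw [this]
  refine Submodule.add_mem _ (fine_numS h hσ _ le_rfl).1 (Submodule.sum_mem _ fun i _ =>
    Submodule.smul_mem _ _ ?_)
  exact sdD_sub_mem (fine_numS h (hσ.face i)) (numS_face A B σ i)

lemma dS_smR (A B : Set E) {k : ℕ} (x : SC E (k + 1)) :
    dS k (smR A B k x) = dS k x - dS k (smH A B k (dS k x)) := by
  rw [smR_apply, map_sub, map_sub, dS_dS, sub_zero]

lemma smR_dS (A B : Set E) {k : ℕ} (x : SC E (k + 2)) :
    smR A B k (dS (k + 1) x) = dS (k + 1) (smR A B (k + 1) x) := by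
  rw [dS_smR, smR_apply, dS_dS, map_zero, sub_zero]

lemma ev_comp {k l : ℕ} (φ : Sx E l → ℤ) (f : SC E k →ₗ[ℤ] SC E l) (x : SC E k) :
    ev (fun σ => ev φ (f (Finsupp.single σ 1))) x = ev φ (f x) := by
  suffices h : ev (fun σ => ev φ (f (Finsupp.single σ 1))) = ev φ ∘ₗ f from LinearMap.congr_fun h x
  refine Finsupp.lhom_ext' fun s => LinearMap.ext_ring ?_
  simp only [LinearMap.comp_apply, Finsupp.lsingle_apply]
  rw [ev_single]

lemma cb_comp {k l : ℕ} (φ : Sx E l → ℤ) (f : SC E k →ₗ[ℤ] SC E l) (s : Sx E (k + 1)) :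
    cb (fun σ => ev φ (f (Finsupp.single σ 1))) s = ev φ (f (dS k (Finsupp.single s 1))) := by
  rw [← ev_dS_single, ev_comp]

lemma cob_of_small {A B : Set E} (h : Exc A B) {k : ℕ} {φ : Sx E (k + 1) → ℤ}
    (hφ : Cocyc (A ∪ B) φ) {ψ : Sx E k → ℤ} (hψ : ∀ s, Small A B s → φ s = cb ψ s) :
    Cob (A ∪ B) φ := by
  refine ⟨fun σ => ψ σ - ev ψ ((dS k ∘ₗ smH A B k) (Finsupp.single σ 1)) +
    ev φ (smH A B k (Finsupp.single σ 1)), fun s hs => ?_⟩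
  have e1 := cb_add (ψ - fun σ => ev ψ ((dS k ∘ₗ smH A B k) (Finsupp.single σ 1)))
    (fun σ => ev φ (smH A B k (Finsupp.single σ 1))) s
  rw [cb_sub, cb_comp, cb_comp, ← ev_dS_single ψ] at e1
  refine Eq.trans ?_ e1.symm
  have e2 : ev φ (smR A B k (Finsupp.single s 1)) = ev ψ (dS k (smR A B k (Finsupp.single s 1))) :=
    ev_eq_of_ssupp (ev φ) (ev ψ ∘ₗ dS k) (fun s hs => by
      rw [LinearMap.comp_apply, ev_dS_single, ev_single, hψ s hs]) (smR_mem h hs)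
  have e3 : ev φ (dS (k + 1) (smH A B (k + 1) (Finsupp.single s 1))) = 0 := by
    rw [smH_single]
    exact ev_dS_eq_zero φ hφ (sdD_mem _ hs)
  rw [dS_smR, smR_apply, map_sub, map_sub, e3, map_sub, ev_single] at e2
  rw [LinearMap.comp_apply]
  linarith

lemma exists_cocyc {A B : Set E} (h : Exc A B) {k : ℕ} {φ : Sx E (k + 1) → ℤ}
    (hφ : ∀ s : Sx E (k + 2), Small A B s → cb φ s = 0) :
    ∃ φ', Cocyc (A ∪ B) φ' ∧ ∃ χ, ∀ s, Small A B s → φ' s = φ s + cb χ s := by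
  refine ⟨fun σ => ev φ (smR A B k (Finsupp.single σ 1)), fun s hs => ?_,
    - fun σ => ev φ (smH A B k (Finsupp.single σ 1)), fun s hs => ?_⟩
  · rw [cb_comp, smR_dS]
    exact ev_dS_eq_zero φ hφ (smR_mem h hs)
  · have e3 : ev φ (dS (k + 1) (smH A B (k + 1) (Finsupp.single s 1))) = 0 := by
      rw [smH_single]
      rcases hs with hs | hs
      · exact ev_dS_eq_zero φ (fun s hs => hφ s (Or.inl hs)) (sdD_mem _ hs)
      · exact ev_dS_eq_zero φ (fun s hs => hφ s (Or.inr hs)) (sdD_mem _ hs)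
    have e4 := cb_sub 0 (fun σ => ev φ (smH A B k (Finsupp.single σ 1))) s
    rw [cb_comp, zero_sub] at e4
    change ev φ (smR A B k (Finsupp.single s 1)) = _
    rw [e4, smR_apply, map_sub, map_sub, e3, ev_single]
    simp [cb, sub_eq_add_neg]

end Subdivision

section MayerVietoris

variable {E : Type} [TopologicalSpace E]

open Classical in
lemma cob_union {A B : Set E} (h : Exc A B) {k : ℕ} {φ : Sx E (k + 1) → ℤ}
    (hφ : Cocyc (A ∪ B) φ) {α β ε : Sx E k → ℤ} (hα : ∀ s, Inn A s → φ s = cb α s)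
    (hβ : ∀ s, Inn B s → φ s = cb β s) (hε : Cocyc A ε)
    (hαβ : ∀ s, Inn A s → Inn B s → α s - β s = ε s) : Cob (A ∪ B) φ := by
  refine cob_of_small h hφ (ψ := fun s => if Inn A s then α s - ε s else β s) ?_
  rintro s (hs | hs)
  · rw [cb_congr (ψ := α - ε) (fun s hs => by rw [if_pos hs]; rfl) hs, cb_sub, hε s hs, sub_zero,
      hα s hs]
  · rw [cb_congr (ψ := β) (fun s hs => ?_) hs, hβ s hs]
    split_ifs with hA
    · rw [← hαβ s hA hs, sub_sub_cancel]
    · rfl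

open Classical in
lemma HZ_left {A B : Set E} (h : Exc A B) {k : ℕ} (hI : HZ (A ∩ B) (k + 1))
    (hU : HZ (A ∪ B) (k + 1)) : HZ A (k + 1) := by
  intro a ha
  obtain ⟨γ, hγ⟩ := hI a (ha.mono Set.inter_subset_left)
  obtain ⟨φ', hφ', χ, hχ⟩ := exists_cocyc h (φ := fun s => if Inn A s then a s else cb γ s) (by
    rintro s (hs | hs)
    · rw [cb_congr (ψ := a) (fun s hs => by rw [if_pos hs]) hs, ha s hs]
    · rw [cb_congr (ψ := cb γ) (fun s hs => ?_) hs, cb_cb]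
      split_ifs with hA
      · exact hγ s fun t => ⟨hA t, hs t⟩
      · rfl)
  obtain ⟨ψ, hψ⟩ := hU φ' hφ'
  refine ⟨ψ - χ, fun s hs => ?_⟩
  have := hχ s (Or.inl hs)
  rw [if_pos hs, hψ s (hs.mono Set.subset_union_left)] at this
  rw [cb_sub]
  linarith

lemma Inn.elim_empty {k : ℕ} {s : Sx E k} (h : Inn ∅ s) {C : Prop} : C :=
  (h (stdSimplex.vertex 0)).elim

lemma cob_empty : ∀ {k : ℕ} (φ : Sx E k → ℤ), Cob ∅ φ
  | 0, _ => fun _ hs => hs.elim_empty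
  | _ + 1, _ => ⟨0, fun _ hs => hs.elim_empty⟩

lemma Inn.union_zero {A B : Set E} {s : Sx E 0} (h : Inn (A ∪ B) s) : Inn A s ∨ Inn B s := by
  rcases h (stdSimplex.vertex 0) with h | h
  · exact Or.inl fun t => by rwa [Subsingleton.elim t (stdSimplex.vertex 0)]
  · exact Or.inr fun t => by rwa [Subsingleton.elim t (stdSimplex.vertex 0)]

lemma exists_cocyc_eq {A B : Set E} : ∀ {k : ℕ} {δ ε : Sx E k → ℤ}, Cob B (δ - ε) →
    Cocyc A ε → ∃ ε', Cocyc A ε' ∧ ∀ s, Inn B s → δ s = ε' s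
  | 0, δ, ε, h, hε => ⟨ε, hε, fun s hs => sub_eq_zero.1 (h s hs)⟩
  | k + 1, δ, ε, ⟨η, h⟩, hε => ⟨ε + cb η, fun s hs => by rw [cb_add, hε s hs, cb_cb, add_zero],
      fun s hs => by
        have := h s hs
        rw [Pi.sub_apply] at this
        rw [Pi.add_apply, ← this, add_sub_cancel]⟩

end MayerVietoris

section Spheres

variable {E : Type} [NormedAddCommGroup E] [NormedSpace ℝ E] {c : ℕ}

/-- The projection along the vectors `e i` with coordinates `y i`. -/
def prj (y : Fin c → E →L[ℝ] ℝ) (e : Fin c → E) : C(E, E) :=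
  ⟨fun z => z - ∑ i, y i z • e i, by fun_prop⟩

/-- The points over `X` having a nonzero coordinate among the first `n` ones. -/
def Yst (y : Fin c → E →L[ℝ] ℝ) (e : Fin c → E) (X : Set E) (n : ℕ) : Set E :=
  {z | prj y e z ∈ X ∧ ∃ i : Fin c, (i : ℕ) < n ∧ y i z ≠ 0}

/-- The translation by `v`. -/
def trans (v : E) : C(E, E) := ⟨fun x => x + v, by fun_prop⟩

variable {y : Fin c → E →L[ℝ] ℝ} {e : Fin c → E} {X : Set E}

lemma prj_apply (z : E) : prj y e z = z - ∑ i, y i z • e i := rfl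

lemma prj_add (z w : E) : prj y e (z + w) = prj y e z + prj y e w := by
  simp only [prj_apply, map_add, add_smul, Finset.sum_add_distrib]
  abel

lemma prj_smul (a : ℝ) (z : E) : prj y e (a • z) = a • prj y e z := by
  simp only [prj_apply, map_smul, smul_assoc, smul_sub, Finset.smul_sum]

lemma coord_prj (hye : ∀ i j, y i (e j) = if i = j then 1 else 0) (i : Fin c) (z : E) :
    y i (prj y e z) = 0 := by
  simp [prj_apply, hye]

lemma prj_of_coord {z : E} (h : ∀ i, y i z = 0) : prj y e z = z := by
  simp [prj_apply, h]

lemma prj_prj (hye : ∀ i j, y i (e j) = if i = j then 1 else 0) (z : E) :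
    prj y e (prj y e z) = prj y e z := prj_of_coord fun i => coord_prj hye i z

lemma prj_vec (hye : ∀ i j, y i (e j) = if i = j then 1 else 0) (j : Fin c) :
    prj y e (e j) = 0 := by
  simp [prj_apply, hye]

lemma cob_pull_trans (hye : ∀ i j, y i (e j) = if i = j then 1 else 0)
    (hX : ∀ x ∈ X, ∀ i, y i x = 0) {k n : ℕ} (hn : n < c) (h0 : 0 < n) {φ : Sx E k → ℤ}
    (hφ : Cocyc (Yst y e X (n + 1)) φ) (r : ℝ) (hr : r ≠ 0) :
    Cob X (pull (trans (r • e ⟨n, hn⟩)) φ - pull (trans (e ⟨0, h0.trans hn⟩)) φ) := by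
  refine cob_of_line _ _ (fun x hx a ha ha' => ?_) hφ
  have e1 : (1 - a) • trans (r • e ⟨n, hn⟩) x + a • trans (e ⟨0, h0.trans hn⟩) x =
      x + (((1 - a) * r) • e ⟨n, hn⟩ + a • e ⟨0, h0.trans hn⟩) := by
    simp only [trans, ContinuousMap.coe_mk]
    module
  have hne : (⟨0, h0.trans hn⟩ : Fin c) ≠ ⟨n, hn⟩ := fun h => h0.ne (Fin.ext_iff.1 h)
  rw [e1]
  refine ⟨?_, ?_⟩
  · rw [prj_add, prj_add, prj_smul, prj_smul, prj_vec hye, prj_vec hye, prj_of_coord (hX x hx)]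
    simpa using hx
  · rcases ha.eq_or_lt with rfl | ha
    · exact ⟨⟨n, hn⟩, n.lt_succ_self, by simp [hX x hx, hye, hr]⟩
    · exact ⟨⟨0, h0.trans hn⟩, n.succ_pos, by simp [hX x hx, hye, hne, ha.ne']⟩

lemma cob_half (hye : ∀ i j, y i (e j) = if i = j then 1 else 0) {k n : ℕ} (hn : n < c) (r : ℝ)
    (hr : r ≠ 0) {φ : Sx E k → ℤ}
    (hφ : Cocyc (Yst y e X n ∪ {z | prj y e z ∈ X ∧ 0 < r * y ⟨n, hn⟩ z}) φ) :
    Cob (Yst y e X n ∪ {z | prj y e z ∈ X ∧ 0 < r * y ⟨n, hn⟩ z})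
      (φ - pull (prj y e) (pull (trans (r • e ⟨n, hn⟩)) φ)) := by
  refine cob_of_line (ContinuousMap.id E) ((trans (r • e ⟨n, hn⟩)).comp (prj y e))
    (fun z hz a ha ha' => ?_) hφ
  have hzX : prj y e z ∈ X := hz.elim And.left And.left
  change (1 - a) • z + a • (prj y e z + r • e ⟨n, hn⟩) ∈ _
  have hp : prj y e ((1 - a) • z + a • (prj y e z + r • e ⟨n, hn⟩)) = prj y e z := by
    simp only [prj_add, prj_smul, prj_prj hye, prj_vec hye]
    module
  have hr2 : 0 < r * r := mul_self_pos.2 hr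
  have hyn : y ⟨n, hn⟩ ((1 - a) • z + a • (prj y e z + r • e ⟨n, hn⟩)) =
      (1 - a) * y ⟨n, hn⟩ z + a * r := by
    simp [coord_prj hye, hye]
  rcases ha'.eq_or_lt with rfl | ha'
  · refine Or.inr ⟨by rwa [hp], ?_⟩
    rw [hyn]
    nlinarith
  · rcases hz with ⟨_, i, hi, hyi⟩ | ⟨_, hz⟩
    · refine Or.inl ⟨by rwa [hp], i, hi, ?_⟩
      have hne : i ≠ ⟨n, hn⟩ := fun h => hi.ne (Fin.ext_iff.1 h)
      simp [coord_prj hye, hye, hne, hyi, sub_ne_zero.2 ha'.ne']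
    · refine Or.inr ⟨by rwa [hp], ?_⟩
      rw [hyn]
      have : 0 < (1 - a) * (r * y ⟨n, hn⟩ z) := mul_pos (sub_pos.2 ha') hz
      nlinarith [mul_nonneg ha hr2.le]

lemma exists_cocyc_base (hye : ∀ i j, y i (e j) = if i = j then 1 else 0)
    (hX : ∀ x ∈ X, ∀ i, y i x = 0) : ∀ {n : ℕ}, n ≤ c → ∀ {k : ℕ},
    (∀ j, j + n = k + 1 → HZ X j) → ∀ φ : Sx E k → ℤ, Cocyc (Yst y e X n) φ →
      ∃ ψ, Cocyc X ψ ∧ Cob (Yst y e X n) (φ - pull (prj y e) ψ)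
  | 0, _, k, _, φ, _ => by
    have : Yst y e X 0 = ∅ := Set.eq_empty_of_forall_notMem fun z hz => by
      obtain ⟨_, i, hi, _⟩ := hz
      exact Nat.not_lt_zero _ hi
    rw [this]
    exact ⟨0, fun s _ => by simp [cb], cob_empty _⟩
  | n + 1, hn, k, hj, φ, hφ => by
    set i₀ : Fin c := ⟨n, hn⟩ with hi₀
    set A : ℝ → Set E := fun r => Yst y e X n ∪ {z | prj y e z ∈ X ∧ 0 < r * y i₀ z} with hA
    have hAY : ∀ r, A r ⊆ Yst y e X (n + 1) := by
      rintro r z (⟨hz, i, hi, h⟩ | ⟨hz, h⟩)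
      · exact ⟨hz, i, hi.trans n.lt_succ_self, h⟩
      · exact ⟨hz, i₀, n.lt_succ_self, fun h0 => by simp [h0] at h⟩
    have hUn : A 1 ∪ A (-1) = Yst y e X (n + 1) := by
      refine (Set.union_subset (hAY 1) (hAY (-1))).antisymm ?_
      rintro z ⟨hz, i, hi, h⟩
      rcases (Nat.lt_succ_iff.1 hi).lt_or_eq with hi | hi
      · exact Or.inl (Or.inl ⟨hz, i, hi, h⟩)
      · obtain rfl : i = i₀ := Fin.ext hi
        rcases h.lt_or_gt with h | h
        · exact Or.inr (Or.inr ⟨hz, by linarith⟩)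
        · exact Or.inl (Or.inr ⟨hz, by linarith⟩)
    have hIn : A 1 ∩ A (-1) ⊆ Yst y e X n := by
      rintro z ⟨hz | ⟨_, hz⟩, hz' | ⟨_, hz'⟩⟩
      · exact hz
      · exact hz
      · exact hz'
      · linarith
    have hExc : Exc (A 1) (A (-1)) := by
      have hop : ∀ r : ℝ, IsOpen {z : E | (∃ i : Fin c, (i : ℕ) < n ∧ y i z ≠ 0) ∨ 0 < r * y i₀ z} := by
        intro r
        have h1 : IsOpen (⋃ i : Fin c, ⋃ _ : (i : ℕ) < n, {z : E | y i z ≠ 0}) :=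
          isOpen_iUnion fun i => isOpen_iUnion fun _ =>
            isOpen_ne_fun (y i).continuous continuous_const
        convert h1.union (isOpen_lt (continuous_const (y := (0 : ℝ)))
          (continuous_const.mul (y i₀).continuous : Continuous fun z => r * y i₀ z)) using 1
        ext z
        simp
      have hsub : ∀ r, A r ⊆
          {z : E | (∃ i : Fin c, (i : ℕ) < n ∧ y i z ≠ 0) ∨ 0 < r * y i₀ z} := by
        rintro r z (⟨_, hz⟩ | ⟨_, hz⟩)
        · exact Or.inl hz
        · exact Or.inr hz
      have hsub' : ∀ r, (A 1 ∪ A (-1)) ∩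
          {z : E | (∃ i : Fin c, (i : ℕ) < n ∧ y i z ≠ 0) ∨ 0 < r * y i₀ z} ⊆ A r := by
        rintro r z ⟨hz, hz'⟩
        rw [hUn] at hz
        exact hz'.imp (fun h => ⟨hz.1, h⟩) fun h => ⟨hz.1, h⟩
      exact ⟨_, _, hop 1, hop (-1), hsub 1, hsub (-1), hsub' 1, hsub' (-1)⟩
    have hmaps : ∀ r : ℝ, r ≠ 0 → Set.MapsTo (trans (r • e i₀)) X (Yst y e X (n + 1)) := by
      intro r hr x hx
      refine ⟨?_, i₀, n.lt_succ_self, by simp [trans, hX x hx, hye, hr]⟩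
      change prj y e (x + r • e i₀) ∈ X
      rwa [prj_add, prj_smul, prj_vec hye, smul_zero, add_zero, prj_of_coord (hX x hx)]
    have hdiff : Cob X (pull (trans ((1 : ℝ) • e i₀)) φ - pull (trans ((-1 : ℝ) • e i₀)) φ) := by
      rcases n.eq_zero_or_pos with rfl | h0
      · exact hj k rfl _ ((hφ.pull _ (hmaps 1 one_ne_zero)).sub
          (hφ.pull _ (hmaps (-1) (by norm_num))))
      · have h1 := cob_pull_trans hye hX hn h0 hφ 1 one_ne_zero
        have h2 := cob_pull_trans hye hX hn h0 hφ (-1) (by norm_num)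
        simpa using h1.sub h2
    refine ⟨pull (trans ((1 : ℝ) • e i₀)) φ, hφ.pull _ (hmaps 1 one_ne_zero), ?_⟩
    have hprj : ∀ r, Set.MapsTo (prj y e) (A r) X := fun r z hz => hz.elim And.left And.left
    have h1 : Cob (A 1) (φ - pull (prj y e) (pull (trans ((1 : ℝ) • e i₀)) φ)) :=
      cob_half hye hn 1 one_ne_zero (hφ.mono (hAY 1))
    have h2 : Cob (A (-1)) (φ - pull (prj y e) (pull (trans ((1 : ℝ) • e i₀)) φ)) := by
      have h3 := (cob_half hye hn (-1) (by norm_num) (hφ.mono (hAY (-1)))).sub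
        (hdiff.pull (prj y e) (hprj (-1)))
      rwa [pull_sub, sub_sub, add_sub_cancel] at h3
    have hcoc : Cocyc (A 1 ∪ A (-1)) (φ - pull (prj y e) (pull (trans ((1 : ℝ) • e i₀)) φ)) := by
      refine Cocyc.sub (by rwa [hUn]) (Cocyc.pull _ (W := X) ?_ (hφ.pull _ (hmaps 1 one_ne_zero)))
      rintro z (hz | hz)
      · exact hprj _ hz
      · exact hprj _ hz
    rw [← hUn]
    generalize φ - pull (prj y e) (pull (trans ((1 : ℝ) • e i₀)) φ) = φ' at h1 h2 hcoc
    cases k with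
    | zero => exact fun s hs => hs.union_zero.elim (h1 s) (h2 s)
    | succ k =>
      obtain ⟨α, hα⟩ := h1
      obtain ⟨β, hβ⟩ := h2
      obtain ⟨ε, hε, hεc⟩ := exists_cocyc_base hye hX (Nat.le_of_succ_le hn) (k := k)
        (fun j h => hj j (by omega)) (α - β) (fun s hs => by
          rw [cb_sub, ← hα s (hs.mono Set.subset_union_left),
            ← hβ s (hs.mono Set.subset_union_left), sub_self])
      obtain ⟨ε', hε', heq⟩ := exists_cocyc_eq (A := A 1) hεc (hε.pull _ (hprj 1))
      exact cob_union hExc hcoc hα hβ hε' fun s hs hs' => heq s fun t => hIn ⟨hs t, hs' t⟩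

lemma HZ_Yst (hye : ∀ i j, y i (e j) = if i = j then 1 else 0)
    (hX : ∀ x ∈ X, ∀ i, y i x = 0) {k : ℕ} (hk : HZ X k) (hj : ∀ j, j + c = k + 1 → HZ X j) :
    HZ (Yst y e X c) k := by
  intro φ hφ
  obtain ⟨ψ, hψ, h⟩ := exists_cocyc_base hye hX le_rfl hj φ hφ
  have := h.add ((hk ψ hψ).pull (prj y e) (U := Yst y e X c) fun z hz => hz.1)
  rwa [sub_add_cancel] at this

end Spheres

section Gysin

lemma exists_radius {E : Type} [PseudoMetricSpace E] {O : Set E} (hO : IsOpen O) : ∃ ε : E → ℝ, Continuous ε ∧ (∀ x, 0 ≤ ε x) ∧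
    (∀ x ∈ O, 0 < ε x) ∧ ∀ x z, dist z x < ε x → z ∈ O ∧ x ∈ O := by
  rcases Oᶜ.eq_empty_or_nonempty with h | h
  · rw [Set.compl_empty_iff] at h
    subst h
    exact ⟨fun _ => 1, continuous_const, fun _ => zero_le_one, fun _ _ => one_pos,
      fun _ _ _ => ⟨trivial, trivial⟩⟩
  · refine ⟨fun x => Metric.infDist x Oᶜ, Metric.continuous_infDist_pt _,
      fun _ => Metric.infDist_nonneg, fun x hx => ?_, fun x z hz => ⟨?_, ?_⟩⟩
    · exact (hO.isClosed_compl.notMem_iff_infDist_pos h).1 (not_not.2 hx)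
    · by_contra hc
      have := Metric.infDist_le_dist_of_mem (x := x) (s := Oᶜ) hc
      rw [dist_comm] at this
      exact this.not_gt hz
    · by_contra hc
      replace hz : dist z x < Metric.infDist x Oᶜ := hz
      rw [Metric.infDist_zero_of_mem (s := Oᶜ) hc] at hz
      exact dist_nonneg.not_gt hz

variable {E : Type} [NormedAddCommGroup E] [NormedSpace ℝ E] {c : ℕ} {y : Fin c → E →L[ℝ] ℝ} {e : Fin c → E}

lemma HZ_tube (hye : ∀ i j, y i (e j) = if i = j then 1 else 0) {L X : Set E} {ε : E → ℝ}
    (hε : Continuous ε) (hL : ∀ z, prj y e z ∈ X → z ∈ L)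
    (hX : ∀ x ∈ X, 0 < ε x) (hLX : ∀ z ∈ L, ‖z - prj y e z‖ < ε (prj y e z) → prj y e z ∈ X)
    (hXy : ∀ x ∈ X, ∀ i, y i x = 0) {k : ℕ}
    (hk : HZ X k) (hj : ∀ j, j + c = k + 1 → HZ X j) :
    HZ {z | z ∈ L ∧ ‖z - prj y e z‖ < ε (prj y e z) ∧ ∃ i, y i z ≠ 0} k := by
  set Q : Set E := {z | z ∈ L ∧ ‖z - prj y e z‖ < ε (prj y e z) ∧ ∃ i, y i z ≠ 0} with hQ
  have hQY : Q ⊆ Yst y e X c := fun z ⟨hz, h, i, hi⟩ => ⟨hLX z hz h, i, i.2, hi⟩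
  have hpos : ∀ z : E, (0 : ℝ) < 1 + ‖z - prj y e z‖ := fun z => by positivity
  set g : C(E, E) := ⟨fun z => prj y e z +
    (ε (prj y e z) / (1 + ‖z - prj y e z‖)) • (z - prj y e z), by
      have := (prj y e).continuous
      refine this.add (Continuous.smul (Continuous.div (hε.comp this) (by fun_prop) fun z =>
        (hpos z).ne') (by fun_prop))⟩ with hg
  have hmem : ∀ z, prj y e z ∈ X → (∃ i, y i z ≠ 0) → ∀ a : ℝ, 0 < a →
      a * ‖z - prj y e z‖ < ε (prj y e z) → prj y e z + a • (z - prj y e z) ∈ Q := by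
    rintro z hz ⟨i, hi⟩ a ha h
    have hp : prj y e (prj y e z + a • (z - prj y e z)) = prj y e z := by
      have : z - prj y e z = z + (-1 : ℝ) • prj y e z := by module
      rw [this]
      simp only [prj_add, prj_smul, prj_prj hye]
      module
    refine ⟨hL _ (by rwa [hp]), ?_, i, ?_⟩
    · rwa [hp, add_sub_cancel_left, norm_smul, Real.norm_of_nonneg ha.le]
    · simp [coord_prj hye, ha.ne', hi]
  have hf : ∀ z, prj y e z ∈ X → 0 < ε (prj y e z) / (1 + ‖z - prj y e z‖) := fun z hz =>
    div_pos (hX _ hz) (hpos z)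
  have hfl : ∀ z, prj y e z ∈ X →
      ε (prj y e z) / (1 + ‖z - prj y e z‖) * ‖z - prj y e z‖ < ε (prj y e z) := fun z hz => by
    rw [div_mul_eq_mul_div, div_lt_iff₀ (hpos z)]
    nlinarith [hX _ hz]
  have hgm : Set.MapsTo g (Yst y e X c) Q := fun z ⟨hz, i, _, hi⟩ =>
    hmem z hz ⟨i, hi⟩ _ (hf z hz) (hfl z hz)
  intro φ hφ
  have h1 : Cob Q (φ - pull g φ) := by
    refine cob_of_line (ContinuousMap.id E) g (fun z hz a ha ha' => ?_) hφ
    have hzX := (hQY hz).1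
    have e1 : (1 - a) • ContinuousMap.id E z + a • g z = prj y e z +
        ((1 - a) + a * (ε (prj y e z) / (1 + ‖z - prj y e z‖))) • (z - prj y e z) := by
      simp only [hg, ContinuousMap.coe_mk, ContinuousMap.id_apply]
      module
    rw [e1]
    have h2 := hf z hzX
    have h3 := hfl z hzX
    have h4 := hz.2.1
    refine hmem z hzX hz.2.2 _ ?_ ?_
    · rcases ha'.eq_or_lt with rfl | ha'
      · simpa using h2
      · have := mul_nonneg ha h2.le
        linarith
    · rw [add_mul, mul_assoc]
      rcases ha'.eq_or_lt with rfl | ha'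
      · simpa using h3
      · have := mul_le_mul_of_nonneg_left h3.le ha
        have := mul_lt_mul_of_pos_left h4 (sub_pos.2 ha')
        linarith
  have h2 := h1.add ((HZ_Yst hye hXy hk hj _ (hφ.pull g hgm)).mono hQY)
  rwa [sub_add_cancel] at h2

lemma HZ_diff (hye : ∀ i j, y i (e j) = if i = j then 1 else 0) {L H : Submodule ℝ E}
    (hHL : H ≤ L) (hH : IsClosed (H : Set E)) (heL : ∀ i, e i ∈ L)
    (hyH : ∀ z ∈ L, z ∈ H ↔ ∀ i, y i z = 0) {O : Set E} (hO : IsOpen O) {k : ℕ}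
    (hM : HZ ((L : Set E) ∩ O) (k + 1)) (hX : HZ ((H : Set E) ∩ O) (k + 1))
    (hj : ∀ j, j + c = k + 2 → HZ ((H : Set E) ∩ O) j) :
    HZ (((L : Set E) ∩ O) \ H) (k + 1) := by
  obtain ⟨ε, hε, hε0, hεO, hεb⟩ := exists_radius hO
  have hprjL : ∀ z, prj y e z ∈ L ↔ z ∈ L := fun z =>
    L.sub_mem_iff_left (L.sum_mem fun i _ => L.smul_mem _ (heL i))
  have hprjH : ∀ z ∈ L, prj y e z ∈ H := fun z hz =>
    (hyH _ ((hprjL z).2 hz)).2 fun i => coord_prj hye i z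
  have hball : ∀ z, ‖z - prj y e z‖ < ε (prj y e z) → z ∈ O ∧ prj y e z ∈ O := fun z hz =>
    hεb _ _ (by rwa [dist_eq_norm])
  set T : Set E := {z | z ∈ L ∧ ‖z - prj y e z‖ < ε (prj y e z)} with hT
  have hUn : ((L : Set E) ∩ O) \ H ∪ T = (L : Set E) ∩ O := by
    refine Set.Subset.antisymm (Set.union_subset Set.sdiff_subset fun z hz =>
      ⟨hz.1, (hball z hz.2).1⟩) fun z hz => ?_
    by_cases hzH : z ∈ H
    · refine Or.inr ⟨hz.1, ?_⟩
      rw [prj_of_coord ((hyH z hz.1).1 hzH), sub_self, norm_zero]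
      exact hεO z hz.2
    · exact Or.inl ⟨hz, hzH⟩
  have hIn : ((L : Set E) ∩ O) \ H ∩ T =
      {z | z ∈ (L : Set E) ∧ ‖z - prj y e z‖ < ε (prj y e z) ∧ ∃ i, y i z ≠ 0} := by
    ext z
    constructor
    · rintro ⟨⟨hz, hzH⟩, -, h⟩
      refine ⟨hz.1, h, ?_⟩
      by_contra! hc
      exact hzH ((hyH z hz.1).2 hc)
    · rintro ⟨hz, h, i, hi⟩
      exact ⟨⟨⟨hz, (hball z h).1⟩, fun hzH => hi ((hyH z hz).1 hzH i)⟩, hz, h⟩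
  have hcont := (prj y e).continuous
  have hExc : Exc (((L : Set E) ∩ O) \ H) T := by
    refine ⟨(H : Set E)ᶜ, {z | ‖z - prj y e z‖ < ε (prj y e z)}, hH.isOpen_compl,
      isOpen_lt (by fun_prop) (hε.comp hcont), fun z hz => hz.2, fun z hz => hz.2, ?_, ?_⟩
    · rw [hUn]
      exact fun z hz => hz
    · rw [hUn]
      exact fun z hz => ⟨hz.1.1, hz.2⟩
  refine HZ_left hExc ?_ (by rwa [hUn])
  rw [hIn]
  refine HZ_tube hye hε (X := (H : Set E) ∩ O) (fun z hz => (hprjL z).1 (hHL hz.1))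
    (fun x hx => hεO x hx.2) (fun z hz h => ⟨hprjH z hz, (hball z h).2⟩)
    (fun x hx => (hyH x (hHL hx.1)).1 hx.1) hX hj

end Gysin

section Arrangements

variable {E : Type} [NormedAddCommGroup E] [NormedSpace ℝ E]

lemma HZ_star {U : Set E} (h : ∀ x ∈ U, ∀ a : ℝ, 0 ≤ a → a ≤ 1 → (1 - a) • x ∈ U) (k : ℕ) :
    HZ U (k + 1) := by
  intro φ hφ
  have h1 : Cob U (φ - pull (ContinuousMap.const E (0 : E)) φ) :=
    cob_of_line (ContinuousMap.id E) (ContinuousMap.const E 0) (fun x hx a ha ha' => by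
      simpa using h x hx a ha ha') hφ
  suffices h2 : Cob U (pull (ContinuousMap.const E (0 : E)) φ) by
    have := h1.add h2
    rwa [sub_add_cancel] at this
  set v := φ (ContinuousMap.const _ 0) with hv
  have h3 : pull (ContinuousMap.const E (0 : E)) φ = fun _ => v := by
    funext s
    exact congrArg φ (by ext; rfl)
  rw [h3]
  rcases Nat.even_or_odd k with hk | hk
  · refine ⟨0, fun s hs => ?_⟩
    have h0 : (0 : E) ∈ U := by
      simpa using h _ (hs (stdSimplex.vertex 0)) 1 zero_le_one le_rfl
    have h4 := hφ (ContinuousMap.const _ 0) fun _ => h0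
    have h5 : cb φ (ContinuousMap.const _ (0 : E)) = ∑ i : Fin (k + 3), (-1 : ℤ) ^ (i : ℕ) * v := rfl
    rw [h5, ← Finset.sum_mul, Fin.sum_neg_one_pow, if_neg (by grind), one_mul] at h4
    simp [h4, cb]
  · refine ⟨fun _ => v, fun s hs => ?_⟩
    have h5 : cb (fun _ => v) s = ∑ i : Fin (k + 2), (-1 : ℤ) ^ (i : ℕ) * v := rfl
    rw [h5, ← Finset.sum_mul, Fin.sum_neg_one_pow, if_neg (by grind), one_mul]

variable [FiniteDimensional ℝ E]

lemma exists_coord {L H : Submodule ℝ E} (hHL : H ≤ L) {c : ℕ}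
    (hc : Module.finrank ℝ H + c = Module.finrank ℝ L) :
    ∃ (y : Fin c → E →L[ℝ] ℝ) (e : Fin c → E), (∀ i j, y i (e j) = if i = j then 1 else 0) ∧
      (∀ i, e i ∈ L) ∧ ∀ z ∈ L, z ∈ H ↔ ∀ i, y i z = 0 := by
  set H' : Submodule ℝ L := H.comap L.subtype with hH'
  have h1 : Module.finrank ℝ H' = Module.finrank ℝ H :=
    (Submodule.comapSubtypeEquivOfLe hHL).finrank_eq
  have h2 : Module.finrank ℝ (L ⧸ H') = Module.finrank ℝ (Fin c → ℝ) := by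
    have := H'.finrank_quotient_add_finrank
    rw [Module.finrank_fin_fun]
    omega
  set q := LinearEquiv.ofFinrankEq _ _ h2
  obtain ⟨g, hg⟩ := LinearMap.exists_extend (q.toLinearMap ∘ₗ H'.mkQ)
  have hg' : ∀ z : L, g z = q (H'.mkQ z) := fun z => LinearMap.congr_fun hg z
  have hsurj : ∀ i : Fin c, ∃ z : L, g z = Pi.single i 1 := fun i => by
    obtain ⟨z, hz⟩ := H'.mkQ_surjective (q.symm (Pi.single i 1))
    exact ⟨z, by rw [hg', hz, q.apply_symm_apply]⟩
  choose e he using hsurj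
  refine ⟨fun i => LinearMap.toContinuousLinearMap (LinearMap.proj i ∘ₗ g), fun i => e i,
    fun i j => ?_, fun i => (e i).2, fun z hz => ?_⟩
  · simp [he, Pi.single_apply]
  · have h3 : g z = 0 ↔ z ∈ H := by
      rw [hg' ⟨z, hz⟩, q.map_eq_zero_iff, Submodule.mkQ_apply, Submodule.Quotient.mk_eq_zero]
      rfl
    rw [← h3, funext_iff]
    rfl

lemma isOpen_compl_arr (𝒜 : Finset (Submodule ℝ E)) : IsOpen {x : E | ∀ S ∈ 𝒜, x ∉ S} := by
  have h1 : IsOpen (⋂ S ∈ 𝒜, ((S : Set E)ᶜ)) :=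
    isOpen_biInter_finset fun S _ => S.closed_of_finiteDimensional.isOpen_compl
  convert h1 using 1
  ext x
  simp

open Classical in
lemma HZ_arr {c : ℕ} (hc : 2 ≤ c) (n : ℕ) : ∀ (L : Submodule ℝ E) (𝒜 : Finset (Submodule ℝ E)),
    𝒜.card = n → (∀ S ∈ 𝒜, S ≤ L) →
    (∀ S ∈ 𝒜, Module.finrank ℝ S + c = Module.finrank ℝ L) →
    (∀ s ⊆ 𝒜, s.Nonempty →
      ∃ m : ℕ, Module.finrank ℝ ↥(sInf (s : Set (Submodule ℝ E))) + c * m = Module.finrank ℝ L) →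
    ∀ k, ¬ (c - 1) ∣ k → HZ ((L : Set E) ∩ {x | ∀ S ∈ 𝒜, x ∉ S}) k := by
  induction n using Nat.strong_induction_on with
  | _ n ih =>
  intro L 𝒜 hn hle hcodim hint k hk
  obtain ⟨k, rfl⟩ : ∃ l, k = l + 1 := Nat.exists_eq_succ_of_ne_zero fun h => hk (h ▸ dvd_zero _)
  rcases 𝒜.eq_empty_or_nonempty with rfl | ⟨H, hH⟩
  · refine HZ_star ?_ k
    intro x hx a _ _
    exact ⟨L.smul_mem _ hx.1, fun S hS => absurd hS (Finset.notMem_empty S)⟩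
  have hlt : (𝒜.erase H).card < n := hn ▸ Finset.card_erase_lt_of_mem hH
  obtain ⟨y, e, hye, heL, hyH⟩ := exists_coord (hle H hH) (hcodim H hH)
  have hM := ih _ hlt L (𝒜.erase H) rfl (fun S hS => hle S (Finset.mem_of_mem_erase hS))
    (fun S hS => hcodim S (Finset.mem_of_mem_erase hS))
    fun s hs => hint s (hs.trans (Finset.erase_subset _ _))
  have hX : ∀ j, ¬ (c - 1) ∣ j → HZ ((H : Set E) ∩ {x | ∀ S ∈ 𝒜.erase H, x ∉ S}) j := by
    have heq : (H : Set E) ∩ {x | ∀ S ∈ 𝒜.erase H, x ∉ S} =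
        (H : Set E) ∩ {x | ∀ S ∈ (𝒜.erase H).image (fun K => H ⊓ K), x ∉ S} := by
      ext x
      refine and_congr_right fun hx => ?_
      rw [SetLike.mem_coe] at hx
      change (∀ S ∈ 𝒜.erase H, x ∉ S) ↔ ∀ S ∈ (𝒜.erase H).image (fun K => H ⊓ K), x ∉ S
      rw [Finset.forall_mem_image]
      simp only [Submodule.mem_inf, hx, true_and]
    rw [heq]
    refine ih _ (Finset.card_image_le.trans_lt hlt) H _ rfl ?_ ?_ ?_
    · rw [Finset.forall_mem_image]
      exact fun K _ => inf_le_left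
    · rw [Finset.forall_mem_image]
      intro K hK
      have hKA := Finset.mem_of_mem_erase hK
      obtain ⟨m, hm⟩ := hint {H, K} (by
        intro S hS
        rcases Finset.mem_insert.1 hS with rfl | hS
        · exact hH
        · exact Finset.mem_singleton.1 hS ▸ hKA) ⟨H, by simp⟩
      rw [Finset.coe_pair, sInf_pair] at hm
      have h1 := Submodule.finrank_sup_add_finrank_inf_eq H K
      have h2 := Submodule.finrank_mono (sup_le (hle H hH) (hle K hKA))
      have h3 := hcodim H hH
      have h4 := hcodim K hKA
      have h5 : Module.finrank ℝ ↥(H ⊓ K) < Module.finrank ℝ H := by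
        refine Submodule.finrank_lt_finrank_of_lt (inf_le_left.lt_of_ne fun h => ?_)
        have h6 : H ≤ K := inf_eq_left.1 h
        exact Finset.ne_of_mem_erase hK (Submodule.eq_of_le_of_finrank_eq h6 (by omega)).symm
      have h6 : 1 < m := by
        by_contra! h
        have : c * m ≤ c * 1 := Nat.mul_le_mul_left c h
        omega
      have h7 : m < 3 := by
        by_contra! h
        have : c * 3 ≤ c * m := Nat.mul_le_mul_left c h
        omega
      obtain rfl : m = 2 := by omega
      omega
    · intro s hs hne
      obtain ⟨t, ht, rfl⟩ := Finset.subset_image_iff.1 hs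
      have htne : t.Nonempty := Finset.image_nonempty.1 hne
      obtain ⟨m, hm⟩ := hint (insert H t) (Finset.insert_subset hH
        (ht.trans (Finset.erase_subset _ _))) ⟨H, by simp⟩
      have h1 : sInf ((t.image fun K => H ⊓ K : Finset _) : Set (Submodule ℝ E)) =
          sInf ((insert H t : Finset _) : Set (Submodule ℝ E)) := by
        rw [Finset.coe_insert, sInf_insert, Finset.coe_image, sInf_image]
        obtain ⟨K, hK⟩ := htne
        refine le_antisymm (le_inf ?_ (le_sInf fun K hK => ?_)) (le_iInf₂ fun K hK => ?_)
        · exact (iInf₂_le K hK).trans inf_le_left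
        · exact (iInf₂_le K hK).trans inf_le_right
        · exact inf_le_inf_left _ (sInf_le hK)
      rw [h1]
      have h2 : Module.finrank ℝ ↥(sInf ((insert H t : Finset _) : Set (Submodule ℝ E))) ≤
          Module.finrank ℝ H := Submodule.finrank_mono (sInf_le (by simp))
      have h3 := hcodim H hH
      cases m with
      | zero => omega
      | succ m => exact ⟨m, by rw [mul_add, mul_one] at hm; omega⟩
  have hset : (L : Set E) ∩ {x | ∀ S ∈ 𝒜, x ∉ S} =
      ((L : Set E) ∩ {x | ∀ S ∈ 𝒜.erase H, x ∉ S}) \ H := by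
    ext x
    constructor
    · rintro ⟨hx, h⟩
      exact ⟨⟨hx, fun S hS => h S (Finset.mem_of_mem_erase hS)⟩, h H hH⟩
    · rintro ⟨⟨hx, h⟩, hxH⟩
      refine ⟨hx, fun S hS => ?_⟩
      by_cases hSH : S = H
      · rw [hSH]
        exact hxH
      · exact h S (Finset.mem_erase.2 ⟨hSH, hS⟩)
  rw [hset]
  refine HZ_diff hye (hle H hH) H.closed_of_finiteDimensional heL hyH (isOpen_compl_arr _)
    (hM _ hk) (hX _ hk) fun j hj => hX j fun hdvd => hk ?_
  rw [show k + 1 = j + (c - 1) by omega]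
  exact Nat.dvd_add_self_right.2 hdvd

end Arrangements

section Transfer

variable {E : Type} [TopologicalSpace E] {P : E → Prop}

/-- The singular simplex of a subspace given by a simplex of the ambient space. -/
def toSing {k : ℕ} (s : Sx E k) (h : ∀ t, P (s t)) : Sing (TopCat.of {x : E // P x}) k :=
  ((TopCat.of {x : E // P x}).toSSetObjEquiv (op (SimplexCategory.mk k))).symm
    ⟨fun t => ⟨s t, h t⟩, s.continuous.subtype_mk h⟩

/-- The simplex of the ambient space given by a singular simplex of a subspace. -/
def ofSing {k : ℕ} (s : Sing (TopCat.of {x : E // P x}) k) : Sx E k :=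
  ContinuousMap.comp ⟨Subtype.val, continuous_subtype_val⟩
    ((TopCat.of {x : E // P x}).toSSetObjEquiv (op (SimplexCategory.mk k)) s)

lemma ofSing_prop {k : ℕ} (s : Sing (TopCat.of {x : E // P x}) k) (t : Dl k) : P (ofSing s t) :=
  (((TopCat.of {x : E // P x}).toSSetObjEquiv (op (SimplexCategory.mk k)) s) t).2

lemma toSing_ofSing {k : ℕ} (s : Sing (TopCat.of {x : E // P x}) k) :
    toSing (ofSing s) (ofSing_prop s) = s :=
  Equiv.symm_apply_apply _ _

open Classical in
/-- Extension by zero of a cochain of a subspace to the ambient space. -/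
def extZ {k : ℕ} (f : Sing (TopCat.of {x : E // P x}) k → ℤ) (s : Sx E k) : ℤ :=
  if hs : ∀ t, P (s t) then f (toSing s hs) else 0

lemma extZ_of_prop {k : ℕ} (f : Sing (TopCat.of {x : E // P x}) k → ℤ) (s : Sx E k)
    (hs : ∀ t, P (s t)) : extZ f s = f (toSing s hs) :=
  dif_pos hs

lemma subsingleton_HredT {k : ℕ} (h : HZ {x : E | P x} (k + 1)) :
    Subsingleton (HredT (TopCat.of {x : E // P x}) (k + 1)) := by
  refine Submodule.Quotient.subsingleton_iff.2 (eq_top_iff.2 fun f _ => ?_)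
  obtain ⟨f, hf⟩ := f
  refine ⟨?_, hf⟩
  have hf0 : cob (TopCat.of {x : E // P x}) (k + 1) f = 0 := hf
  obtain ⟨χ, hχ⟩ := h (extZ f) (by
    intro s hs
    refine Eq.trans ?_ (congrFun hf0 (toSing s hs))
    refine Finset.sum_congr rfl fun i _ => congrArg _ ?_
    exact extZ_of_prop f _ fun _ => hs _)
  refine ⟨fun s => χ (ofSing s), funext fun s => ?_⟩
  have h1 := hχ (ofSing s) (ofSing_prop s)
  have h2 : extZ f (ofSing s) = f s :=
    (extZ_of_prop f _ (ofSing_prop s)).trans (congrArg f (toSing_ofSing s))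
  exact h1.symm.trans h2

end Transfer

end CArr

/-- let `𝒜` be a real `c`-arrangement, `c ≥ 2` (every subspace has codimension
`c`, every intersection of members has codimension divisible by `c`).  Then the reduced
integral cohomology of the complement `M(𝒜)` vanishes in degree `k` unless `c - 1 ∣ k`. -/
theorem stmt7 (N c : ℕ) (hc : 2 ≤ c) (𝒜 : Finset (Submodule ℝ (Fin N → ℝ)))
    (hcodim : ∀ S ∈ 𝒜, Module.finrank ℝ ↥S + c = N)
    (hint : ∀ s ⊆ 𝒜, s.Nonempty →
      ∃ m : ℕ, Module.finrank ℝ ↥(sInf (s : Set (Submodule ℝ (Fin N → ℝ)))) + c * m = N) :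
    ∀ k : ℕ, ¬ ((c - 1) ∣ k) →
      Subsingleton (HredT (TopCat.of {x : Fin N → ℝ // ∀ S ∈ 𝒜, x ∉ S}) k) := by
  intro k hk
  obtain ⟨k, rfl⟩ : ∃ l, k = l + 1 := Nat.exists_eq_succ_of_ne_zero fun h => hk (h ▸ dvd_zero _)
  refine CArr.subsingleton_HredT ?_
  have h := CArr.HZ_arr hc _ (⊤ : Submodule ℝ (Fin N → ℝ)) 𝒜 rfl (fun _ _ => le_top)
    (by simpa using hcodim) (by simpa using hint) _ hk
  rwa [Submodule.top_coe, Set.univ_inter] at h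
end
end
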